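/- Assume the Riemann hypothesis. Then for every real t ≥ e^18 one has −Re(ζ'/ζ(1 + i t)) ≤ 2 log log t + 1 − γ − log 4 − (8 log log t)/(log t) + 7/(log t), where ζ is the Riemann zeta-function and γ is the Euler–Mascheroni constant. -/

import Mathlib

open Complex

section PartA
open Complex Filter Topology Set Metric

namespace ZL

/-- Phragmen-Lindelof for real parts in the right half plane. -/
theorem re_nonneg_of_boundary {f : ℂ → ℂ} (hd : DiffContOnCl ℂ f {z | 0 < z.re}) {A : ℝ}
    (hA : 0 ≤ A) (hgrow : ∀ z : ℂ, 0 ≤ z.re → ‖f z‖ ≤ A * (1 + Real.sqrt ‖z‖))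
    (hb : ∀ y : ℝ, 0 ≤ (f (y * I)).re) {z : ℂ} (hz : 0 ≤ z.re) : 0 ≤ (f z).re := by
  have key : ∀ ε : ℝ, 0 < ε → 0 ≤ (f z).re + ε * z.re := by
    intro ε hε
    have h1 : ‖Complex.exp (-(f z) - ε * z)‖ ≤ 1 := by
      apply PhragmenLindelof.right_half_plane_of_bounded_on_real (f := fun z => Complex.exp (-(f z) - ε * z)) (C := 1) _ _ _ _ hz
      · have : DiffContOnCl ℂ (fun z => -(f z) - ε * z) {z : ℂ | 0 < z.re} := by
          apply DiffContOnCl.sub hd.neg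
          exact (Differentiable.diffContOnCl (by fun_prop))
        exact ⟨this.1.cexp, this.2.cexp⟩
      · refine ⟨1, by norm_num, 2 * A + ε, ?_⟩
        apply Asymptotics.IsBigO.of_bound 1
        have h2 : ∀ᶠ z : ℂ in Bornology.cobounded ℂ ⊓ 𝓟 {z : ℂ | 0 < z.re}, 1 ≤ ‖z‖ :=
          (tendsto_norm_cobounded_atTop.eventually_ge_atTop 1).filter_mono inf_le_left
        have h3 : ∀ᶠ z : ℂ in Bornology.cobounded ℂ ⊓ 𝓟 {z : ℂ | 0 < z.re}, 0 < z.re :=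
          mem_inf_of_right (mem_principal_self _)
        filter_upwards [h2, h3] with w hw1 hw2
        rw [Complex.norm_exp, Real.norm_eq_abs, Real.abs_exp, one_mul, Real.exp_le_exp, Real.rpow_one]
        have h4 := hgrow w hw2.le
        have h5 := (abs_le.1 (abs_re_le_norm (f w))).1
        have h6 : Real.sqrt ‖w‖ ≤ ‖w‖ := Real.sqrt_le_iff.2 ⟨by positivity, by nlinarith⟩
        simp only [sub_re, neg_re, mul_re, ofReal_re, ofReal_im, zero_mul, sub_zero]
        nlinarith [norm_nonneg w]
      · refine ⟨Real.exp (A + A ^ 2 / ε), ?_⟩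
        rw [eventually_map]
        filter_upwards [eventually_ge_atTop 0] with x hx
        rw [Complex.norm_exp, Real.exp_le_exp]
        have h4 := hgrow x (by simpa using hx)
        have h5 := (abs_le.1 (abs_re_le_norm (f x))).1
        have h6 : ‖(x:ℂ)‖ = x := by simp [abs_of_nonneg hx]
        rw [h6] at h4
        simp only [sub_re, neg_re, mul_re, ofReal_re, ofReal_im, zero_mul, sub_zero]
        set q := Real.sqrt x
        have hq : q * q = x := Real.mul_self_sqrt hx
        have : A * q ≤ A ^ 2 / ε + ε * x := by
          rw [← hq, div_add' _ _ _ hε.ne', le_div_iff₀ hε]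
          nlinarith [sq_nonneg (A - ε * q), sq_nonneg (ε * q), sq_nonneg A]
        nlinarith
      · intro y
        rw [Complex.norm_exp]
        have := hb y
        simp only [Real.exp_le_one_iff]
        simp
        linarith
    rw [Complex.norm_exp, Real.exp_le_one_iff] at h1
    simp at h1
    linarith
  by_contra hneg
  push Not at hneg
  have := key (-(f z).re / (2 * (1 + z.re))) (by apply div_pos <;> linarith)
  have h1 : -(f z).re / (2 * (1 + z.re)) * z.re ≤ -(f z).re / 2 := by
    rw [div_mul_eq_mul_div, div_le_div_iff₀ (by linarith) (by norm_num)]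
    nlinarith
  linarith

end ZL

end PartA

section PartB
open Complex Filter Topology Set Metric

namespace ZL

noncomputable def za (n : ℕ) (s : ℂ) : ℂ :=
  (s - 1) * ((n + 1 : ℝ) : ℂ) ^ (-s) + ((n + 2 : ℝ) : ℂ) ^ (1 - s) - ((n + 1 : ℝ) : ℂ) ^ (1 - s)

theorem za_diff (n : ℕ) : Differentiable ℂ (za n) := by
  have h1 : ((n + 1 : ℝ) : ℂ) ≠ 0 := by norm_cast
  have h2 : ((n + 2 : ℝ) : ℂ) ≠ 0 := by norm_cast
  unfold za
  intro s
  have e1 : DifferentiableAt ℂ (fun s : ℂ => ((n + 1 : ℝ) : ℂ) ^ (-s)) s :=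
    DifferentiableAt.const_cpow (by fun_prop) (Or.inl h1)
  have e2 : DifferentiableAt ℂ (fun s : ℂ => ((n + 2 : ℝ) : ℂ) ^ (1-s)) s :=
    DifferentiableAt.const_cpow (by fun_prop) (Or.inl h2)
  have e3 : DifferentiableAt ℂ (fun s : ℂ => ((n + 1 : ℝ) : ℂ) ^ (1-s)) s :=
    DifferentiableAt.const_cpow (by fun_prop) (Or.inl h1)
  exact (((differentiableAt_id.sub_const 1).mul e1).add e2).sub e3

theorem cpow_diff_bound {a u : ℝ} (ha : 1 ≤ a) (hu : a ≤ u) {s : ℂ} (hs : 0 < s.re) :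
    ‖(a : ℂ) ^ (-s) - (u : ℂ) ^ (-s)‖ ≤ ‖s‖ * a ^ (-s.re - 1) * (u - a) := by
  rcases eq_or_ne s 0 with rfl | hs0
  · simp at hs
  have hd : ∀ x ∈ Icc a u, HasDerivWithinAt (fun x : ℝ => (x : ℂ) ^ (-s)) (-s * (x:ℂ) ^ (-s - 1)) (Icc a u) x := by
    intro x hx
    have hx0 : (0:ℝ) < x := by linarith [hx.1]
    exact (hasDerivAt_ofReal_cpow_const (x := x) hx0.ne' (r := -s) (neg_ne_zero.2 hs0)).hasDerivWithinAt
  have := norm_image_sub_le_of_norm_deriv_le_segment' (C := ‖s‖ * a ^ (-s.re - 1)) hd (by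
    intro x hx
    have hx0 : (0:ℝ) < x := by linarith [hx.1]
    rw [norm_mul, norm_neg, Complex.norm_cpow_eq_rpow_re_of_pos hx0]
    gcongr
    simp only [sub_re, neg_re, one_re]
    apply Real.rpow_le_rpow_of_nonpos (by linarith) hx.1 (by linarith)) u (right_mem_Icc.2 hu)
  rw [norm_sub_rev]
  exact this

theorem za_bound (n : ℕ) {s : ℂ} (hs : 0 < s.re) :
    ‖za n s‖ ≤ ‖s - 1‖ * ‖s‖ * (n + 1 : ℝ) ^ (-s.re - 1) := by
  rcases eq_or_ne s 1 with rfl | hs1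
  · simp [za]
  set a : ℝ := n + 1 with hadef
  have ha : 1 ≤ a := by simp [a]
  have hd : ∀ x ∈ Icc a (a+1), HasDerivWithinAt
      (fun x : ℝ => (s - 1) * (((x - a : ℝ) : ℂ) * (a : ℂ) ^ (-s)) + (x : ℂ) ^ (1 -s))
      ((s - 1) * ((a : ℂ) ^ (-s) - (x:ℂ) ^ (-s))) (Icc a (a+1)) x := by
    intro x hx
    have hx0 : (0:ℝ) < x := by linarith [hx.1]
    have h4 : (1 - s) ≠ 0 := sub_ne_zero.2 (Ne.symm hs1)
    have h2 := (hasDerivAt_ofReal_cpow_const (x := x) hx0.ne' (r := 1 - s) h4)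
    have h3 : HasDerivAt (fun x : ℝ => (s - 1) * (((x - a : ℝ) : ℂ) * (a : ℂ) ^ (-s)))
        ((s - 1) * (((1 : ℝ) : ℂ) * (a : ℂ) ^ (-s))) x := by
      apply HasDerivAt.const_mul
      apply HasDerivAt.mul_const
      exact HasDerivAt.ofReal_comp ((hasDerivAt_id x).sub_const a)
    have e1 : (1 - s - 1) = -s := by ring
    rw [e1] at h2
    have e2 : ((s - 1) * (((1 : ℝ) : ℂ) * (a : ℂ) ^ (-s))) + (1 - s) * (x : ℂ) ^ (-s) = (s - 1) * ((a : ℂ) ^ (-s) - (x:ℂ) ^ (-s)) := by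
      push_cast; ring
    have h5 := (h3.add h2).hasDerivWithinAt (s := Icc a (a+1))
    rw [e2] at h5
    exact h5
  have := norm_image_sub_le_of_norm_deriv_le_segment' (C := ‖s-1‖ * (‖s‖ * a ^ (-s.re - 1))) hd (by
    intro x hx
    rw [norm_mul]
    gcongr
    refine (cpow_diff_bound ha hx.1 hs).trans ?_
    have : 0 ≤ ‖s‖ * a ^ (-s.re - 1) := by positivity
    nlinarith [hx.2, hx.1]) (a+1) (right_mem_Icc.2 (by linarith))
  have e : za n s = ((s - 1) * (((a + 1 - a : ℝ) : ℂ) * (a : ℂ) ^ (-s)) + ((a + 1 : ℝ) : ℂ) ^ (1 -s))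
     - ((s - 1) * (((a - a : ℝ) : ℂ) * (a : ℂ) ^ (-s)) + ((a : ℝ) : ℂ) ^ (1 -s)) := by
    unfold za
    have : (n + 2 : ℝ) = a + 1 := by rw [hadef]; ring
    rw [this, add_sub_cancel_left, sub_self, ← hadef, ofReal_one, ofReal_zero]
    ring
  rw [e]
  refine this.trans (le_of_eq ?_)
  ring

theorem summable_shift_rpow {r : ℝ} (hr : r < -1) : Summable (fun n : ℕ => ((n : ℝ) + 1) ^ r) := by
  have := (summable_nat_add_iff 1).2 (Real.summable_nat_rpow.2 hr)
  simpa using this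

theorem za_summable {s : ℂ} (hs : 0 < s.re) : Summable (fun n => za n s) := by
  apply Summable.of_norm_bounded (g := fun n : ℕ => ‖s - 1‖ * ‖s‖ * (n + 1 : ℝ) ^ (-s.re - 1)) _ (fun n => za_bound n hs)
  exact (summable_shift_rpow (by linarith)).mul_left _

theorem za_tsum_of_one_lt {s : ℂ} (hs : 1 < s.re) : riemannZeta₁ s = 1 + ∑' n, za n s := by
  have hs1 : s ≠ 1 := by rintro rfl; simp at hs
  have h1 : Summable (fun n : ℕ => ((n + 1 : ℝ) : ℂ) ^ (-s)) := by
    have := (summable_nat_add_iff 1).2 (Complex.summable_one_div_nat_cpow.2 hs)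
    simpa [Complex.cpow_neg] using this
  have h2 := za_summable (s := s) (by linarith)
  have h3 : Summable (fun n : ℕ => ((n + 2 : ℝ) : ℂ) ^ (1 - s) - ((n + 1 : ℝ) : ℂ) ^ (1 - s)) := by
    refine (h2.sub (h1.mul_left (s-1))).congr ?_
    intro n
    unfold za; ring
  have h4 : ∑' n : ℕ, (((n + 2 : ℝ) : ℂ) ^ (1 - s) - ((n + 1 : ℝ) : ℂ) ^ (1 - s)) = -1 := by
    have t1 := h3.hasSum.tendsto_sum_nat
    have t2 : ∀ N : ℕ, ∑ n ∈ Finset.range N, (((n + 2 : ℝ) : ℂ) ^ (1 - s) - ((n + 1 : ℝ) : ℂ) ^ (1 - s)) = ((N + 1 : ℝ) : ℂ) ^ (1 - s) - 1 := by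
      intro N
      have := Finset.sum_range_sub (fun n : ℕ => ((n + 1 : ℝ) : ℂ) ^ (1 - s)) N
      simp only [Nat.cast_zero, zero_add, ofReal_one, one_cpow] at this
      rw [← this]
      apply Finset.sum_congr rfl
      intro n _
      have : ((n + 1 : ℕ) : ℝ) + 1 = n + 2 := by push_cast; ring
      rw [this]
    simp_rw [t2] at t1
    have t3 : Tendsto (fun N : ℕ => ((N + 1 : ℝ) : ℂ) ^ (1 - s) - 1) atTop (𝓝 (0 - 1)) := by
      apply Tendsto.sub_const
      rw [tendsto_zero_iff_norm_tendsto_zero]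
      have : ∀ N : ℕ, ‖((N + 1 : ℝ) : ℂ) ^ (1 - s)‖ = ((N:ℝ) + 1) ^ (-(s.re - 1)) := by
        intro N
        rw [Complex.norm_cpow_eq_rpow_re_of_pos (by positivity)]
        simp
      simp_rw [this]
      exact (tendsto_rpow_neg_atTop (by linarith)).comp (tendsto_atTop_add_const_right _ _ tendsto_natCast_atTop_atTop)
    simpa using tendsto_nhds_unique t1 t3
  have h5 : ∑' n, za n s = (s - 1) * ∑' n : ℕ, ((n + 1 : ℝ) : ℂ) ^ (-s) + -1 := by
    rw [← h4, ← tsum_mul_left, ← (h1.mul_left _).tsum_add h3]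
    congr 1; ext n; unfold za; ring
  rw [h5]
  have h6 := riemannZeta_eq_inv_sub_mul hs1
  have h7 := zeta_eq_tsum_one_div_nat_add_one_cpow hs
  have h8 : riemannZeta s = ∑' n : ℕ, ((n + 1 : ℝ) : ℂ) ^ (-s) := by
    rw [h7]; congr 1; ext n; simp [Complex.cpow_neg]
  rw [← h8, h6]
  have : s - 1 ≠ 0 := sub_ne_zero.2 hs1
  field_simp
  ring

theorem za_tsum_diff {σ : ℝ} (hσ : 0 < σ) :
    DifferentiableOn ℂ (fun s => 1 + ∑' n, za n s) {s : ℂ | σ < s.re ∧ ‖s‖ < 1 / σ} := by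
  apply DifferentiableOn.const_add
  apply differentiableOn_tsum_of_summable_norm
    (u := fun n : ℕ => (1/σ + 1) * (1/σ) * ((n : ℝ) + 1) ^ (-σ - 1))
  · exact (summable_shift_rpow (by linarith)).mul_left _
  · intro n; exact (za_diff n).differentiableOn
  · exact (isOpen_lt continuous_const continuous_re).inter (isOpen_lt continuous_norm continuous_const)
  · intro n s hs
    refine (za_bound n (hσ.trans hs.1)).trans ?_
    have h1 : ‖s - 1‖ ≤ 1/σ + 1 := by
      refine (norm_sub_le _ _).trans ?_
      simp only [norm_one]; linarith [hs.2.le]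
    have h2 := hs.2.le
    gcongr
    · have : (0:ℝ) ≤ n := by positivity
      linarith
    · exact hs.1.le

theorem za_tsum_eq {s : ℂ} (hs : 0 < s.re) : riemannZeta₁ s = 1 + ∑' n, za n s := by
  have hd : DifferentiableOn ℂ (fun s => 1 + ∑' n, za n s) {s : ℂ | 0 < s.re} := by
    intro w hw
    obtain ⟨σ, h1, h2, h3⟩ : ∃ σ : ℝ, 0 < σ ∧ σ < w.re ∧ ‖w‖ < 1 / σ := by
      have hw' : 0 < w.re := hw
      refine ⟨min (w.re / 2) (1 / (‖w‖ + 1)), ?_, ?_, ?_⟩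
      · exact lt_min (by linarith) (by positivity)
      · exact (min_le_left _ _).trans_lt (by linarith)
      · have hm : 0 < min (w.re / 2) (1 / (‖w‖ + 1)) := lt_min (by linarith) (by positivity)
        rw [lt_div_iff₀ hm]
        calc ‖w‖ * min (w.re / 2) (1 / (‖w‖ + 1)) ≤ ‖w‖ * (1 / (‖w‖ + 1)) := by
              gcongr; exact min_le_right _ _
          _ < 1 := by rw [mul_one_div, div_lt_one (by positivity)]; linarith
    apply DifferentiableAt.differentiableWithinAt
    apply (za_tsum_diff h1).differentiableAt
    exact ((isOpen_lt continuous_const continuous_re).inter (isOpen_lt continuous_norm continuous_const)).mem_nhds ⟨h2, h3⟩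
  have ho : IsOpen {s : ℂ | 0 < s.re} := isOpen_lt continuous_const continuous_re
  have hA := hd.analyticOnNhd ho
  have hB : AnalyticOnNhd ℂ riemannZeta₁ {s : ℂ | 0 < s.re} :=
    (differentiable_riemannZeta₁.differentiableOn).analyticOnNhd ho
  have hc : IsPreconnected {s : ℂ | 0 < s.re} := (convex_halfSpace_re_gt 0).isPreconnected
  have := hB.eqOn_of_preconnected_of_eventuallyEq hA hc (z₀ := 2) (by simp) (by
    have : {s : ℂ | 1 < s.re} ∈ 𝓝 (2 : ℂ) := (isOpen_lt continuous_const continuous_re).mem_nhds (by simp)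
    filter_upwards [this] with s hs
    exact za_tsum_of_one_lt hs)
  exact this hs

/-- polynomial growth of `riemannZeta₁`. -/
theorem zeta1_growth : ∃ C : ℝ, 0 < C ∧ ∀ s : ℂ, 1/4 ≤ s.re → ‖riemannZeta₁ s‖ ≤ C * (1 + ‖s‖) ^ 2 := by
  have hsum : Summable (fun n : ℕ => ((n : ℝ) + 1) ^ (-(1/4) - 1 : ℝ)) := summable_shift_rpow (by norm_num)
  refine ⟨1 + ∑' n : ℕ, ((n : ℝ) + 1) ^ (-(1/4) - 1 : ℝ), ?_, ?_⟩
  · have : 0 ≤ ∑' n : ℕ, ((n : ℝ) + 1) ^ (-(1/4) - 1 : ℝ) := tsum_nonneg (fun n => by positivity)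
    linarith
  · intro s hs
    rw [za_tsum_eq (by linarith)]
    have hb : ∀ n : ℕ, ‖za n s‖ ≤ (1 + ‖s‖) ^ 2 * ((n : ℝ) + 1) ^ (-(1/4) - 1 : ℝ) := by
      intro n
      refine (za_bound n (by linarith)).trans ?_
      have h1 : ‖s - 1‖ ≤ 1 + ‖s‖ := by
        refine (norm_sub_le _ _).trans ?_
        simp only [norm_one]; linarith
      have h2 : ‖s‖ ≤ 1 + ‖s‖ := by linarith
      rw [sq]
      gcongr
      have : (0:ℝ) ≤ n := by positivity
      linarith
    have h3 := tsum_of_norm_bounded (hsum.mul_left ((1 + ‖s‖) ^ 2)).hasSum hb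
    rw [tsum_mul_left] at h3
    refine (norm_add_le _ _).trans ?_
    rw [norm_one]
    nlinarith [norm_nonneg s]

end ZL

end PartB

section PartC
open Complex Filter Topology Set Metric

namespace ZL

theorem nonvanish_lower {f : ℂ → ℂ} {c : ℂ} {R K : ℝ} (hR : 0 < R) (hK : 0 < K)
    (hf : DifferentiableOn ℂ f (ball c R)) (hne : ∀ z ∈ ball c R, f z ≠ 0)
    (hb : ∀ z ∈ ball c R, ‖f z‖ ≤ Real.exp K * ‖f c‖) {z : ℂ} (hz : z ∈ ball c R) :
    ‖f c‖ * Real.exp (-(2 * K * ‖z - c‖ / (R - ‖z - c‖))) ≤ ‖f z‖ := by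
  have hc : c ∈ ball c R := mem_ball_self hR
  have hd : DifferentiableOn ℂ (fun z => deriv f z / f z) (ball c R) :=
    (hf.deriv isOpen_ball).div hf hne
  obtain ⟨g, hg0, hg⟩ := hd.isExactOn_ball.with_val_at c 0
  have hexp : ∀ w ∈ ball c R, f w = f c * Complex.exp (g w) := by
    have hder : ∀ w ∈ ball c R, HasDerivAt (fun w => f w * Complex.exp (-(g w))) 0 w := by
      intro w hw
      have h1 := (hf.differentiableAt (isOpen_ball.mem_nhds hw)).hasDerivAt
      have h2 := (hg w hw).neg.cexp
      have h3 := h1.mul h2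
      have e : deriv f w * Complex.exp (-(g w)) + f w * (Complex.exp (-(g w)) * -(deriv f w / f w)) = 0 := by
        have := hne w hw
        field_simp
        ring
      rw [← e]
      exact h3
    intro w hw
    have hconst := isOpen_ball.is_const_of_deriv_eq_zero (f := fun w => f w * Complex.exp (-(g w)))
      (convex_ball c R).isPreconnected
      (fun w hw => (hder w hw).differentiableAt.differentiableWithinAt)
      (fun w hw => (hder w hw).deriv) hw hc
    simp only [hg0, neg_zero, Complex.exp_zero, mul_one] at hconst
    rw [← hconst, mul_assoc, ← Complex.exp_add]
    simp
  have hfc : 0 < ‖f c‖ := norm_pos_iff.2 (hne c hc)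
  have hre : ∀ w ∈ ball c R, (g w).re ≤ K := by
    intro w hw
    have h1 := hb w hw
    rw [hexp w hw, norm_mul, Complex.norm_exp, mul_comm] at h1
    exact Real.exp_le_exp.1 (le_of_mul_le_mul_right h1 hfc)
  have hmem : ∀ u ∈ ball (0:ℂ) R, u + c ∈ ball c R := by
    intro u hu
    simpa [mem_ball, dist_eq_norm] using hu
  have hBC := Complex.borelCaratheodory_zero (f := fun u => g (u + c)) (z := z - c) hK (R := R)
    (by
      intro u hu
      exact ((hg (u + c) (hmem u hu)).comp_add_const u c).differentiableAt.differentiableWithinAt)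
    (by intro u hu; exact hre _ (hmem u hu)) hR (by simpa [mem_ball, dist_eq_norm] using hz)
    (by simpa using hg0)
  simp only [sub_add_cancel] at hBC
  rw [hexp z hz, norm_mul, Complex.norm_exp]
  gcongr
  have := (abs_le.1 (abs_re_le_norm (g z))).1
  linarith

theorem zeta1_eq {s : ℂ} (hs : s ≠ 1) : riemannZeta₁ s = (s - 1) * riemannZeta s := by
  rw [riemannZeta_eq_inv_sub_mul hs]
  have : s - 1 ≠ 0 := sub_ne_zero.2 hs
  field_simp

theorem zeta1_ne_zero (RH : RiemannHypothesis) {s : ℂ} (hs : 1/2 < s.re) : riemannZeta₁ s ≠ 0 := by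
  rcases eq_or_ne s 1 with rfl | hs1
  · simp [riemannZeta₁_one]
  rw [zeta1_eq hs1]
  refine mul_ne_zero (sub_ne_zero.2 hs1) ?_
  intro h0
  have := RH s h0 (by
    rintro ⟨n, rfl⟩
    simp at hs
    have : (0:ℝ) ≤ n := by positivity
    linarith) hs1
  linarith

theorem zeta_sub_one_bound {s : ℂ} (hs : 2 ≤ s.re) : ‖riemannZeta s - 1‖ ≤ 7/10 := by
  rw [zeta_eq_tsum_one_div_nat_add_one_cpow (by linarith)]
  have h1 : Summable (fun n : ℕ => 1 / ((n:ℂ) + 1) ^ s) := by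
    have := (summable_nat_add_iff 1).2 (Complex.summable_one_div_nat_cpow.2 (by linarith : 1 < s.re))
    simpa using this
  rw [h1.tsum_eq_zero_add]
  simp only [Nat.cast_zero, zero_add, one_cpow, div_one, add_sub_cancel_left]
  have h2 := hasSum_zeta_two
  have h3 := h2.summable
  have h4 : HasSum (fun n : ℕ => 1 / ((n + 2 : ℕ) : ℝ) ^ 2) (Real.pi ^ 2 / 6 - 1) := by
    have := (hasSum_nat_add_iff' 2).2 h2
    simpa [Finset.sum_range_succ] using this
  refine (tsum_of_norm_bounded h4 ?_).trans ?_
  · intro n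
    rw [norm_div, norm_one]
    have e : ((n + 1 : ℕ) : ℂ) + 1 = (((n + 2 : ℕ) : ℝ) : ℂ) := by push_cast; ring
    rw [e, Complex.norm_cpow_eq_rpow_re_of_pos (by positivity), ← Real.rpow_natCast]
    gcongr
    · push_cast; linarith [(Nat.cast_nonneg n : (0:ℝ) ≤ n)]
    · exact_mod_cast hs
  · nlinarith [Real.pi_lt_d2, Real.pi_pos]

theorem zeta1_lower_two {s : ℂ} (hs : 2 ≤ s.re) : 3/10 ≤ ‖riemannZeta₁ s‖ := by
  have hs1 : s ≠ 1 := by rintro rfl; norm_num at hs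
  rw [zeta1_eq hs1, norm_mul]
  have h1 : 3/10 ≤ ‖riemannZeta s‖ := by
    have := zeta_sub_one_bound hs
    have h2 := norm_sub_norm_le (1:ℂ) (1 - riemannZeta s)
    rw [norm_sub_rev 1 (riemannZeta s), norm_one] at h2
    simp only [sub_sub_cancel] at h2
    linarith
  have h2 : 1 ≤ ‖s - 1‖ := by
    have := (abs_le.1 (abs_re_le_norm (s-1))).2
    simp at this; linarith
  nlinarith

theorem zeta1_lower (RH : RiemannHypothesis) {h : ℝ} (h0 : 0 < h) :
    ∃ B : ℝ, 0 < B ∧ ∀ s : ℂ, 1/2 + h ≤ s.re → Real.exp (-(B * (1 + ‖s‖))) ≤ ‖riemannZeta₁ s‖ := by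
  obtain ⟨C, hC, hgrow⟩ := zeta1_growth
  set K : ℝ := |Real.log C| + 8 with hKdef
  have hK : 8 ≤ K := by simp [K]
  have he : Real.exp (-2) ≤ 3/10 := by
    have : (2.7182818283:ℝ) < Real.exp 1 := Real.exp_one_gt_d9
    have e2 : Real.exp (-2) = (Real.exp 1 * Real.exp 1)⁻¹ := by rw [← Real.exp_add, ← Real.exp_neg]; norm_num
    rw [e2, inv_le_comm₀ (by positivity) (by norm_num)]
    nlinarith
  refine ⟨2 + 3 * K / h, by positivity, ?_⟩
  intro s hs
  have hns := norm_nonneg s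
  rcases le_total 2 s.re with h2 | h2
  · refine le_trans ?_ (zeta1_lower_two h2)
    refine le_trans ?_ he
    apply Real.exp_le_exp.2
    have : 0 ≤ 3 * K / h := by positivity
    nlinarith
  · set c : ℂ := 2 + s.im * I with hc
    have hsc : ‖s - c‖ = 2 - s.re := by
      have : s - c = ((s.re - 2 : ℝ) : ℂ) := by
        apply Complex.ext <;> simp [c]
      rw [this, Complex.norm_real, Real.norm_eq_abs, abs_of_nonpos (by linarith)]
      ring
    have hlow : 3/10 ≤ ‖riemannZeta₁ c‖ := zeta1_lower_two (by simp [c])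
    have key := nonvanish_lower (f := riemannZeta₁) (c := c) (R := 3/2) (K := K * (1 + ‖s‖)) (by norm_num)
      (by positivity) differentiable_riemannZeta₁.differentiableOn
      (by
        intro z hz
        apply zeta1_ne_zero RH
        rw [mem_ball, dist_eq_norm] at hz
        have := (abs_le.1 (abs_re_le_norm (z - c))).1
        simp [c] at this
        linarith)
      (by
        intro z hz
        rw [mem_ball, dist_eq_norm] at hz
        have hre : 1/4 ≤ z.re := by
          have := (abs_le.1 (abs_re_le_norm (z - c))).1
          simp [c] at this
          linarith
        refine (hgrow z hre).trans ?_
        have hz2 : ‖z‖ ≤ ‖s‖ + 3 := by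
          have : z = (z - c) + (s - (s - c)) := by ring
          have a1 := norm_add_le (z - c) (s - (s-c))
          have a2 := norm_sub_le s (s - c)
          rw [← this] at a1
          linarith
        have hexp : (1 + ‖z‖) ^ 2 ≤ Real.exp (2 * (‖s‖ + 3)) := by
          have : 1 + ‖z‖ ≤ Real.exp (‖s‖ + 3) := by
            have := Real.add_one_le_exp (‖s‖ + 3)
            linarith
          calc (1 + ‖z‖) ^ 2 ≤ (Real.exp (‖s‖ + 3)) ^ 2 := by gcongr
            _ = _ := by rw [← Real.exp_nat_mul]; norm_num
        have hCe : C ≤ Real.exp |Real.log C| := by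
          nth_rewrite 1 [← Real.exp_log hC]
          exact Real.exp_le_exp.2 (le_abs_self _)
        calc C * (1 + ‖z‖) ^ 2 ≤ Real.exp |Real.log C| * Real.exp (2 * (‖s‖ + 3)) := by gcongr
          _ = Real.exp (|Real.log C| + 2 * (‖s‖ + 3) + 2) * Real.exp (-2) := by
            rw [← Real.exp_add, ← Real.exp_add]; congr 1; ring
          _ ≤ Real.exp (K * (1 + ‖s‖)) * ‖riemannZeta₁ c‖ := by
            gcongr
            · rw [hKdef]; nlinarith [abs_nonneg (Real.log C)]
            · linarith)
      (z := s) (by rw [mem_ball, dist_eq_norm, hsc]; linarith)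
    refine le_trans ?_ key
    rw [hsc]
    have e1 : 2 * (K * (1 + ‖s‖)) * (2 - s.re) / (3/2 - (2 - s.re)) ≤ 3 * K / h * (1 + ‖s‖) := by
      rw [div_le_iff₀ (by linarith), div_mul_eq_mul_div, div_mul_eq_mul_div, le_div_iff₀ h0]
      have : (2 - s.re) * h ≤ 3/2 * (3/2 - (2 - s.re)) := by nlinarith
      have h3 : 0 ≤ K * (1 + ‖s‖) := by positivity
      nlinarith
    calc Real.exp (-((2 + 3 * K / h) * (1 + ‖s‖)))
        ≤ Real.exp (-2) * Real.exp (-(3 * K / h * (1 + ‖s‖))) := by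
          rw [← Real.exp_add]
          apply Real.exp_le_exp.2
          nlinarith
      _ ≤ _ := by
        gcongr
        linarith

end ZL

end PartC

section PartD
open Complex Filter Topology Set Metric

namespace ZL

noncomputable def xi (s : ℂ) : ℂ := riemannZeta₁ s * ((Real.pi : ℂ) ^ (-s / 2) * Gamma (s / 2 + 1))

theorem gamma_arg_ne {s : ℂ} (hs : -2 < s.re) (m : ℕ) : s / 2 + 1 ≠ -(m : ℂ) := by
  intro h
  have := congrArg Complex.re h
  simp at this
  have : (0:ℝ) ≤ m := by positivity
  linarith

theorem xi_diff {s : ℂ} (hs : -2 < s.re) : DifferentiableAt ℂ xi s := by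
  unfold xi
  have h1 : DifferentiableAt ℂ (fun s : ℂ => (Real.pi : ℂ) ^ (-s / 2)) s :=
    DifferentiableAt.const_cpow (by fun_prop) (Or.inl (by exact_mod_cast Real.pi_ne_zero))
  have h2 : DifferentiableAt ℂ (fun s : ℂ => Gamma (s / 2 + 1)) s := by
    have := (Complex.differentiableAt_Gamma (s/2+1) (gamma_arg_ne hs))
    exact DifferentiableAt.comp (g := Gamma) (f := fun s : ℂ => s / 2 + 1) s this (by fun_prop)
  exact differentiable_riemannZeta₁.differentiableAt.mul (h1.mul h2)

theorem xi_ne_zero (RH : RiemannHypothesis) {s : ℂ} (hs : 1/2 < s.re) : xi s ≠ 0 := by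
  unfold xi
  refine mul_ne_zero (zeta1_ne_zero RH hs) (mul_ne_zero ?_ (Gamma_ne_zero (gamma_arg_ne (by linarith))))
  rw [Ne, cpow_eq_zero_iff]
  simp

theorem xi_eq {s : ℂ} (h0 : 0 < s.re) (h1 : s ≠ 1) : xi s = s * (s - 1) / 2 * completedRiemannZeta s := by
  have hs0 : s ≠ 0 := by rintro rfl; simp at h0
  have hG : Gammaℝ s ≠ 0 := Gammaℝ_ne_zero_of_re_pos h0
  rw [xi, zeta1_eq h1, riemannZeta_def_of_ne_zero hs0, Gamma_add_one _ (by simpa using hs0)]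
  have e : (Real.pi : ℂ) ^ (-s / 2) * (s / 2 * Gamma (s / 2)) = s / 2 * Gammaℝ s := by
    rw [Gammaℝ_def]; ring
  rw [e]
  field_simp

theorem xi_one_sub {s : ℂ} (h0 : 0 < s.re) (h1 : s.re < 1) : xi (1 - s) = xi s := by
  have hs0 : s ≠ 0 := by rintro rfl; simp at h0
  have hs1 : s ≠ 1 := by rintro rfl; simp at h1
  rw [xi_eq h0 hs1, xi_eq (by simpa using h1) (by simpa using hs0), completedRiemannZeta_one_sub]
  ring

theorem zeta1_conj (s : ℂ) : riemannZeta₁ ((starRingEnd ℂ) s) = (starRingEnd ℂ) (riemannZeta₁ s) := by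
  rcases eq_or_ne s 1 with rfl | h
  · simp [riemannZeta₁_one]
  rw [zeta1_eq h, zeta1_eq (by
    intro h2; apply h
    have := congrArg (starRingEnd ℂ) h2
    simpa using this), riemannZeta_conj]
  simp

theorem xi_conj_norm (s : ℂ) : ‖xi ((starRingEnd ℂ) s)‖ = ‖xi s‖ := by
  unfold xi
  rw [zeta1_conj, norm_mul, norm_mul, norm_mul, norm_mul, RCLike.norm_conj,
    Complex.norm_cpow_eq_rpow_re_of_pos Real.pi_pos, Complex.norm_cpow_eq_rpow_re_of_pos Real.pi_pos]
  have : (starRingEnd ℂ) s / 2 + 1 = (starRingEnd ℂ) (s / 2 + 1) := by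
    rw [map_add, map_div₀, map_one, Complex.conj_ofNat]
  rw [this, Gamma_conj, RCLike.norm_conj]
  congr 3
  simp [neg_div]

theorem xi_boundary {h : ℝ} (h0 : 0 < h) (h1 : h < 1/2) (y : ℝ) :
    ‖xi (1/2 + y * I - h)‖ = ‖xi (1/2 + y * I + h)‖ := by
  rw [← xi_one_sub (s := 1/2 + y * I - h) (by norm_num; linarith) (by norm_num; linarith), ← xi_conj_norm]
  congr 2
  apply Complex.ext
  · simp; norm_num; ring
  · simp

theorem beta_bound {a : ℂ} (ha : 1 ≤ a.re) {h : ℝ} (hh : 0 < h) : ‖betaIntegral a h‖ ≤ 1 / h := by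
  have h1 : ∫ x in (0:ℝ)..1, (1 - x) ^ (h - 1) = 1 / h := by
    rw [intervalIntegral.integral_comp_sub_left (fun x : ℝ => x ^ (h-1)) 1]
    rw [integral_rpow (Or.inl (by linarith))]
    simp [Real.zero_rpow hh.ne']
  have hint : IntervalIntegrable (fun x : ℝ => (1 - x) ^ (h - 1)) MeasureTheory.volume 0 1 := by
    have := (intervalIntegral.intervalIntegrable_rpow' (a := 1) (b := 0) (r := h - 1) (by linarith))
    simpa using this.comp_sub_left 1
  rw [← h1]
  unfold betaIntegral
  apply intervalIntegral.norm_integral_le_of_norm_le (by norm_num) _ hint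
  refine Filter.Eventually.of_forall ?_
  intro x hx
  rcases eq_or_lt_of_le hx.2 with rfl | hx1
  · have hh1 : 0 ≤ (1 - 1 : ℝ) ^ (h - 1) := by positivity
    rcases eq_or_ne h 1 with rfl | hne
    · simp
    · have : ((1:ℂ) - ((1:ℝ):ℂ)) ^ ((h:ℂ) - 1) = 0 := by
        rw [cpow_eq_zero_iff]
        refine ⟨by simp, sub_ne_zero.2 (by exact_mod_cast hne)⟩
      rw [this]
      simpa using hh1
  · rw [norm_mul, Complex.norm_cpow_eq_rpow_re_of_pos hx.1]
    have e : (1 : ℂ) - x = ((1 - x : ℝ) : ℂ) := by push_cast; ring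
    rw [e, Complex.norm_cpow_eq_rpow_re_of_pos (by linarith)]
    have h2 : x ^ (a - 1).re ≤ 1 := Real.rpow_le_one hx.1.le hx.2 (by simpa using ha)
    have h3 : 0 ≤ (1 - x) ^ (h - 1) := Real.rpow_nonneg (by linarith) _
    simp only [sub_re, ofReal_re, one_re] at *
    nlinarith

theorem gamma_ratio {a : ℂ} (ha : 1 ≤ a.re) {h : ℝ} (hh : 0 < h) :
    ‖Gamma a‖ ≤ 1 / (h * Real.Gamma h) * ‖Gamma (a + h)‖ := by
  have h1 := Complex.Gamma_mul_Gamma_eq_betaIntegral (s := a) (t := h) (by linarith) (by simpa using hh)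
  have hG : 0 < Real.Gamma h := Real.Gamma_pos_of_pos hh
  have h2 := congrArg norm h1
  rw [norm_mul, norm_mul, Complex.Gamma_ofReal, Complex.norm_real, Real.norm_eq_abs, abs_of_pos hG] at h2
  have h3 := beta_bound ha hh
  have h4 : ‖Gamma a‖ * Real.Gamma h ≤ ‖Gamma (a + h)‖ * (1 / h) := by rw [h2]; gcongr
  rw [← le_div_iff₀ hG] at h4
  refine h4.trans (le_of_eq ?_)
  field_simp

/-- bound of the quotient. -/
theorem xi_quot_bound (RH : RiemannHypothesis) {h : ℝ} (h0 : 0 < h) (h1 : h < 1/2) :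
    ∃ D : ℝ, 0 < D ∧ ∀ s : ℂ, 1/2 ≤ s.re →
      ‖xi (s - h) / xi (s + h)‖ ≤ D * (‖riemannZeta₁ (s - h)‖ / ‖riemannZeta₁ (s + h)‖) := by
  have hG : 0 < Real.Gamma h := Real.Gamma_pos_of_pos h0
  refine ⟨Real.pi ^ h * (1 / (h * Real.Gamma h)), by positivity, ?_⟩
  intro s hs
  have hg := gamma_ratio (a := (s - h) / 2 + 1) (by simp; linarith) h0
  have e1 : (s - h) / 2 + 1 + h = (s + h) / 2 + 1 := by ring
  rw [e1] at hg
  have hgn : 0 < ‖Gamma ((s + h) / 2 + 1)‖ := norm_pos_iff.2 (Gamma_ne_zero (gamma_arg_ne (by simp; linarith)))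
  rw [xi, xi, norm_div, norm_mul, norm_mul, norm_mul, norm_mul,
    Complex.norm_cpow_eq_rpow_re_of_pos Real.pi_pos, Complex.norm_cpow_eq_rpow_re_of_pos Real.pi_pos]
  have hz : 0 < ‖riemannZeta₁ (s + h)‖ := norm_pos_iff.2 (zeta1_ne_zero RH (by simp; linarith))
  have e2 : Real.pi ^ (-(s - h) / 2).re = Real.pi ^ h * Real.pi ^ (-(s + h) / 2).re := by
    rw [← Real.rpow_add Real.pi_pos]
    congr 1
    simp; ring
  rw [e2]
  have hp : 0 < Real.pi ^ (-(s + h) / 2).re := Real.rpow_pos_of_pos Real.pi_pos _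
  have hp2 : 0 < Real.pi ^ h := Real.rpow_pos_of_pos Real.pi_pos _
  rw [div_le_iff₀ (by positivity)]
  have e3 : Real.pi ^ h * (1 / (h * Real.Gamma h)) * (‖riemannZeta₁ (s - h)‖ / ‖riemannZeta₁ (s + h)‖) *
     (‖riemannZeta₁ (s + h)‖ * (Real.pi ^ (-(s + h) / 2).re * ‖Gamma ((s + h) / 2 + 1)‖)) =
     ‖riemannZeta₁ (s - h)‖ * (Real.pi ^ h * Real.pi ^ (-(s + h) / 2).re * (1 / (h * Real.Gamma h) * ‖Gamma ((s + h) / 2 + 1)‖)) := by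
    field_simp
  rw [e3]
  gcongr

theorem xi_mono (RH : RiemannHypothesis) {h : ℝ} (h0 : 0 < h) (h1 : h < 1/4) {s : ℂ} (hs : 1/2 ≤ s.re) :
    ‖xi (s - h)‖ ≤ ‖xi (s + h)‖ := by
  obtain ⟨D, hD, hDb⟩ := xi_quot_bound RH h0 (by linarith)
  obtain ⟨C, hC, hCb⟩ := zeta1_growth
  obtain ⟨B, hB, hBb⟩ := zeta1_lower RH h0
  have hne : ∀ s : ℂ, 1/2 ≤ s.re → xi (s + h) ≠ 0 := fun s hs => xi_ne_zero RH (by simp; linarith)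
  have key : ‖xi (1/2 + (s - 1/2) - h) / xi (1/2 + (s - 1/2) + h)‖ ≤ 1 := by
    apply PhragmenLindelof.right_half_plane_of_bounded_on_real
      (f := fun z => xi (1/2 + z - h) / xi (1/2 + z + h)) (C := 1) (z := s - 1/2)
    · have hdiff : ∀ z : ℂ, 0 ≤ z.re → DifferentiableAt ℂ (fun z => xi (1/2 + z - h) / xi (1/2 + z + h)) z := by
        intro z hz
        apply DifferentiableAt.div
        · apply DifferentiableAt.comp (g := xi) (f := fun z : ℂ => 1/2 + z - h) z (xi_diff _) (by fun_prop)
          simp; linarith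
        · apply DifferentiableAt.comp (g := xi) (f := fun z : ℂ => 1/2 + z + h) z (xi_diff _) (by fun_prop)
          simp; linarith
        · apply hne; simpa using hz
      refine ⟨fun z hz => (hdiff z (le_of_lt hz)).differentiableWithinAt, ?_⟩
      rw [Complex.closure_setOfPred_lt_re]
      exact fun z hz => (hdiff z hz).continuousAt.continuousWithinAt
    · refine ⟨1, by norm_num, 2 + B, ?_⟩
      apply Asymptotics.IsBigO.of_bound (D * C * Real.exp 4 * Real.exp (2 * B))
      have h3 : ∀ᶠ z : ℂ in Bornology.cobounded ℂ ⊓ 𝓟 {z : ℂ | 0 < z.re}, 0 < z.re :=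
        mem_inf_of_right (mem_principal_self _)
      filter_upwards [h3] with w hw
      refine (hDb (1/2 + w) (by simpa using hw.le)).trans ?_
      have b1 := hCb (1/2 + w - h) (by simp; linarith)
      have b2 := hBb (1/2 + w + h) (by simp; linarith)
      have hh : ‖(h:ℂ)‖ = h := by rw [Complex.norm_real, Real.norm_eq_abs, abs_of_pos h0]
      have n0 : ‖(1/2 + w : ℂ)‖ ≤ 1/2 + ‖w‖ := by
        refine (norm_add_le _ _).trans ?_
        norm_num
      have n1 : ‖1/2 + w - (h:ℂ)‖ ≤ 1 + ‖w‖ := by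
        refine (norm_sub_le _ _).trans ?_
        rw [hh]; linarith
      have n2 : ‖1/2 + w + (h:ℂ)‖ ≤ 1 + ‖w‖ := by
        refine (norm_add_le _ _).trans ?_
        rw [hh]; linarith
      rw [Real.norm_eq_abs, Real.abs_exp, Real.rpow_one]
      have b3 : ‖riemannZeta₁ (1/2 + w - h)‖ ≤ C * (Real.exp 4 * Real.exp (2 * ‖w‖)) := by
        refine b1.trans ?_
        gcongr
        calc (1 + ‖1/2 + w - (h:ℂ)‖) ^ 2 ≤ (Real.exp (2 + ‖w‖)) ^ 2 := by
              gcongr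
              have := Real.add_one_le_exp (2 + ‖w‖)
              linarith
          _ = _ := by rw [← Real.exp_nat_mul, ← Real.exp_add]; congr 1; push_cast; ring
      have b4 : Real.exp (-(2 * B + B * ‖w‖)) ≤ ‖riemannZeta₁ (1/2 + w + h)‖ := by
        refine le_trans (Real.exp_le_exp.2 ?_) b2
        nlinarith
      calc D * (‖riemannZeta₁ (1/2 + w - h)‖ / ‖riemannZeta₁ (1/2 + w + h)‖)
          ≤ D * (C * (Real.exp 4 * Real.exp (2 * ‖w‖)) / Real.exp (-(2 * B + B * ‖w‖))) := by gcongr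
        _ = _ := by
          rw [div_eq_mul_inv, ← Real.exp_neg, neg_neg, Real.exp_add (2 * B), add_mul 2 B, Real.exp_add (2 * ‖w‖)]
          ring
    · refine ⟨D * (17/3), ?_⟩
      rw [eventually_map]
      filter_upwards [eventually_ge_atTop 3] with x hx
      refine (hDb (1/2 + x) (by simp; linarith)).trans ?_
      apply mul_le_mul_of_nonneg_left _ hD.le
      have r1 : (2:ℝ) ≤ (1/2 + x - h : ℂ).re := by simp; linarith
      have r2 : (2:ℝ) ≤ (1/2 + x + h : ℂ).re := by simp; linarith
      have z1 := zeta_sub_one_bound r1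
      have z2 := zeta_sub_one_bound r2
      have i1 : (1/2 + x - h : ℂ) ≠ 1 := by intro e; rw [e] at r1; norm_num at r1
      have i2 : (1/2 + x + h : ℂ) ≠ 1 := by intro e; rw [e] at r2; norm_num at r2
      have z1' : ‖riemannZeta (1/2 + x - h)‖ ≤ 17/10 := by
        have := norm_sub_norm_le (riemannZeta (1/2 + x - h)) 1
        rw [norm_one] at this
        linarith
      have z2' : 3/10 ≤ ‖riemannZeta (1/2 + x + h)‖ := by
        have := norm_sub_norm_le 1 (riemannZeta (1/2 + x + h))
        rw [norm_one, norm_sub_rev] at this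
        linarith
      rw [zeta1_eq i1, zeta1_eq i2, norm_mul, norm_mul]
      have q1 : ‖(1/2 + x - h - 1 : ℂ)‖ ≤ ‖(1/2 + x + h - 1 : ℂ)‖ := by
        have e1 : (1/2 + x - h - 1 : ℂ) = ((x - h - 1/2 : ℝ) : ℂ) := by push_cast; ring
        have e2 : (1/2 + x + h - 1 : ℂ) = ((x + h - 1/2 : ℝ) : ℂ) := by push_cast; ring
        rw [e1, e2, Complex.norm_real, Complex.norm_real, Real.norm_eq_abs, Real.norm_eq_abs, abs_of_pos (by linarith), abs_of_pos (by linarith)]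
        linarith
      have q2 : 0 < ‖(1/2 + x + h - 1 : ℂ)‖ := norm_pos_iff.2 (sub_ne_zero.2 i2)
      rw [div_le_iff₀ (by positivity)]
      calc ‖(1/2 + x - h - 1 : ℂ)‖ * ‖riemannZeta (1/2 + x - h)‖ ≤ ‖(1/2 + x + h - 1 : ℂ)‖ * (17/10) := by gcongr
        _ = 17/3 * (‖(1/2 + x + h - 1 : ℂ)‖ * (3/10)) := by ring
        _ ≤ _ := by gcongr
    · intro y
      rw [norm_div, xi_boundary h0 (by linarith) y]
      exact div_self_le_one _
    · simpa using hs
  simp only [add_sub_cancel] at key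
  rw [norm_div, div_le_one (norm_pos_iff.2 (hne s hs))] at key
  exact key

/-- The real part of the logarithmic derivative of `xi` is nonnegative right of the critical line. -/
theorem re_logDeriv_xi_nonneg (RH : RiemannHypothesis) {s : ℂ} (hs : 1/2 < s.re) :
    0 ≤ (deriv xi s / xi s).re := by
  have hx := xi_ne_zero RH hs
  have hd := (xi_diff (s := s) (by linarith)).hasDerivAt
  have h1 : HasDerivAt (fun u : ℝ => xi (s + u) / xi s) (deriv xi s / xi s) 0 := by
    apply HasDerivAt.div_const
    have h2 : HasDerivAt (fun z : ℂ => xi (s + z)) (deriv xi s) ((0:ℝ) : ℂ) := by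
      have : HasDerivAt xi (deriv xi s) (s + ((0:ℝ):ℂ)) := by simpa using hd
      exact this.comp_const_add s _
    exact h2.comp_ofReal
  have h2 := h1.norm_sq
  have h3 := (hasDerivWithinAt_iff_tendsto_slope' (s := Ioi (0:ℝ)) (x := 0) (by simp)).1 h2.hasDerivWithinAt
  have h4 := ge_of_tendsto (b := 0) h3 (by
    filter_upwards [self_mem_nhdsWithin, mem_nhdsWithin_of_mem_nhds (Iio_mem_nhds (show (0:ℝ) < 1/4 by norm_num))] with u hu hu2
    have hu0 : 0 < u := hu
    have hu4 : u < 1/4 := hu2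
    rw [slope_def_field]
    apply div_nonneg _ (by linarith)
    have m := xi_mono RH (h := u/2) (by linarith) (by linarith) (s := s + ((u/2 : ℝ):ℂ)) (by simp; linarith)
    have e1 : s + ((u/2 : ℝ):ℂ) - ((u/2 : ℝ):ℂ) = s := by ring
    have e2 : s + ((u/2 : ℝ):ℂ) + ((u/2 : ℝ):ℂ) = s + u := by push_cast; ring
    rw [e1, e2] at m
    have e3 : ‖xi (s + ((0:ℝ):ℂ)) / xi s‖ = 1 := by
      rw [ofReal_zero, add_zero, div_self hx, norm_one]
    rw [e3, norm_div]
    have : 1 ≤ ‖xi (s + u)‖ / ‖xi s‖ := by rwa [one_le_div (norm_pos_iff.2 hx)]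
    nlinarith)
  simp [div_self hx] at h4
  simpa using h4

end ZL

end PartD

section PartE
open Complex Filter Topology Set Metric

namespace ZL

noncomputable def hterm (n : ℕ) (s : ℂ) : ℂ := 1 / (2 * ((n : ℂ) + 1)) - 1 / (s + 2 * ((n : ℂ) + 1))

/-- The archimedean factor. -/
noncomputable def Hs (s : ℂ) : ℂ :=
  ∑' n, hterm n s - ((Real.eulerMascheroniConstant / 2 + Real.log Real.pi / 2 : ℝ) : ℂ)

theorem hden_norm {s : ℂ} (hs : -1 < s.re) (n : ℕ) : (n : ℝ) + 1 ≤ ‖s + 2 * ((n : ℂ) + 1)‖ := by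
  have h := (abs_le.1 (abs_re_le_norm (s + 2 * ((n : ℂ) + 1)))).2
  simp at h
  have : (0:ℝ) ≤ n := by positivity
  linarith

theorem hden_ne {s : ℂ} (hs : -1 < s.re) (n : ℕ) : s + 2 * ((n : ℂ) + 1) ≠ 0 := by
  have := hden_norm hs n
  intro h
  rw [h, norm_zero] at this
  have : (0:ℝ) ≤ n := by positivity
  linarith

theorem hterm_eq {s : ℂ} (hs : -1 < s.re) (n : ℕ) :
    hterm n s = s / (2 * ((n : ℂ) + 1) * (s + 2 * ((n : ℂ) + 1))) := by
  unfold hterm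
  have h1 := hden_ne hs n
  have h2 : (n : ℂ) + 1 ≠ 0 := by exact_mod_cast Nat.succ_ne_zero n
  field_simp
  ring

theorem hnorm (n : ℕ) : ‖2 * ((n : ℂ) + 1)‖ = 2 * ((n : ℝ) + 1) := by
  have : 2 * ((n : ℂ) + 1) = ((2 * ((n : ℝ) + 1) : ℝ) : ℂ) := by push_cast; ring
  rw [this, Complex.norm_real, Real.norm_eq_abs, abs_of_pos (by positivity)]

theorem hterm_bound {s : ℂ} (hs : -1 < s.re) (n : ℕ) :
    ‖hterm n s‖ ≤ ‖s‖ * ((n : ℝ) + 1) ^ (-2 : ℝ) := by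
  rw [hterm_eq hs, norm_div, norm_mul, hnorm]
  have h1 := hden_norm hs n
  have hpos : 0 < ‖s + 2 * ((n : ℂ) + 1)‖ := norm_pos_iff.2 (hden_ne hs n)
  rw [div_le_iff₀ (by positivity)]
  have h2 : ((n : ℝ) + 1) ^ (-2 : ℝ) * (((n:ℝ) + 1) * ((n:ℝ) + 1)) = 1 := by
    rw [← sq, ← Real.rpow_natCast, ← Real.rpow_add (by positivity)]; norm_num
  have h3 : 0 ≤ ((n : ℝ) + 1) ^ (-2 : ℝ) := by positivity
  have h4 : 1 ≤ ((n : ℝ) + 1) ^ (-2 : ℝ) * (2 * ((n:ℝ) + 1) * ‖s + 2 * ((n : ℂ) + 1)‖) := by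
    refine h2.symm.le.trans ?_
    have hn : (0:ℝ) ≤ n := by positivity
    apply mul_le_mul_of_nonneg_left _ h3
    nlinarith
  nlinarith [norm_nonneg s]

theorem hterm_bound_sqrt {s : ℂ} (hs : 0 ≤ s.re) (n : ℕ) :
    ‖hterm n s‖ ≤ Real.sqrt ‖s‖ * ((n : ℝ) + 1) ^ (-3/2 : ℝ) := by
  rw [hterm_eq (by linarith), norm_div, norm_mul, hnorm]
  have h1 := hden_norm (s := s) (by linarith) n
  have h2 : ‖s‖ ≤ ‖s + 2 * ((n : ℂ) + 1)‖ := by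
    rw [Complex.norm_def, Complex.norm_def]
    apply Real.sqrt_le_sqrt
    rw [normSq_apply, normSq_apply]
    simp
    have : (0:ℝ) ≤ n := by positivity
    nlinarith
  have h3 : Real.sqrt ‖s‖ * Real.sqrt ((n:ℝ) + 1) ≤ ‖s + 2 * ((n : ℂ) + 1)‖ := by
    rw [← Real.sqrt_mul (norm_nonneg _)]
    apply Real.sqrt_le_iff.2 ⟨norm_nonneg _, _⟩
    rw [sq]; gcongr
  have h5 : ((n : ℝ) + 1) ^ (-3/2 : ℝ) * (((n:ℝ) + 1) * Real.sqrt ((n:ℝ) + 1)) = 1 := by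
    rw [Real.sqrt_eq_rpow]
    nth_rewrite 2 [← Real.rpow_one ((n:ℝ) + 1)]
    rw [← Real.rpow_add (by positivity), ← Real.rpow_add (by positivity)]; norm_num
  have h6 : 0 ≤ ((n : ℝ) + 1) ^ (-3/2 : ℝ) := by positivity
  have hpos : 0 < ‖s + 2 * ((n : ℂ) + 1)‖ := norm_pos_iff.2 (hden_ne (by linarith) n)
  rw [div_le_iff₀ (by positivity)]
  calc ‖s‖ = Real.sqrt ‖s‖ * Real.sqrt ‖s‖ * (((n : ℝ) + 1) ^ (-3/2 : ℝ) * (((n:ℝ) + 1) * Real.sqrt ((n:ℝ) + 1))) := by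
        rw [h5, mul_one, Real.mul_self_sqrt (norm_nonneg _)]
    _ = Real.sqrt ‖s‖ * ((n : ℝ) + 1) ^ (-3/2 : ℝ) * (1 * ((n:ℝ) + 1) * (Real.sqrt ‖s‖ * Real.sqrt ((n:ℝ) + 1))) := by ring
    _ ≤ _ := by gcongr; norm_num

theorem hterm_summable {s : ℂ} (hs : -1 < s.re) : Summable (fun n => hterm n s) :=
  Summable.of_norm_bounded ((summable_shift_rpow (by norm_num)).mul_left _) (hterm_bound hs)

theorem Hs_diff {s : ℂ} (hs : -1 < s.re) : DifferentiableAt ℂ Hs s := by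
  unfold Hs
  apply DifferentiableAt.sub_const
  have ho : IsOpen {w : ℂ | -1 < w.re ∧ ‖w‖ < ‖s‖ + 1} :=
    (isOpen_lt continuous_const continuous_re).inter (isOpen_lt continuous_norm continuous_const)
  have : DifferentiableOn ℂ (fun s => ∑' n, hterm n s) {w : ℂ | -1 < w.re ∧ ‖w‖ < ‖s‖ + 1} := by
    apply differentiableOn_tsum_of_summable_norm
      (u := fun n : ℕ => (‖s‖ + 1) * ((n : ℝ) + 1) ^ (-2 : ℝ))
    · exact (summable_shift_rpow (by norm_num)).mul_left _
    · intro n w hw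
      unfold hterm
      have := hden_ne hw.1 n
      apply DifferentiableAt.differentiableWithinAt
      fun_prop (disch := assumption)
    · exact ho
    · intro n w hw
      refine (hterm_bound hw.1 n).trans ?_
      have := hw.2.le
      gcongr
  exact this.differentiableAt (ho.mem_nhds ⟨hs, by linarith⟩)

theorem Hs_growth : ∃ C : ℝ, 0 < C ∧ ∀ s : ℂ, 0 ≤ s.re → ‖Hs s‖ ≤ C * (1 + Real.sqrt ‖s‖) := by
  have hsum : Summable (fun n : ℕ => ((n : ℝ) + 1) ^ (-3/2 : ℝ)) := summable_shift_rpow (by norm_num)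
  have h0 : 0 ≤ ∑' n : ℕ, ((n : ℝ) + 1) ^ (-3/2 : ℝ) := tsum_nonneg (fun n => by positivity)
  set K := ‖((Real.eulerMascheroniConstant / 2 + Real.log Real.pi / 2 : ℝ) : ℂ)‖ with hK
  have hK0 : 0 ≤ K := norm_nonneg _
  refine ⟨∑' n : ℕ, ((n : ℝ) + 1) ^ (-3/2 : ℝ) + K + 1, by positivity, ?_⟩
  intro s hs
  have h3 := tsum_of_norm_bounded (hsum.mul_left (Real.sqrt ‖s‖)).hasSum (hterm_bound_sqrt hs)
  rw [tsum_mul_left] at h3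
  unfold Hs
  refine (norm_sub_le _ _).trans ?_
  rw [← hK]
  have := Real.sqrt_nonneg ‖s‖
  nlinarith

theorem digamma_real {x : ℝ} (hx : 0 < x) : digamma x = ((deriv (Real.log ∘ Real.Gamma) x : ℝ) : ℂ) := by
  have hd : DifferentiableAt ℝ Real.Gamma x := Real.differentiableAt_Gamma (fun m => by
    have : (0:ℝ) ≤ m := by positivity
    linarith)
  have hG := Real.Gamma_pos_of_pos hx
  have hdc : DifferentiableAt ℂ Gamma (x:ℂ) := Complex.differentiableAt_Gamma _ (fun m h => by
    have := congrArg Complex.re h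
    simp at this
    have : (0:ℝ) ≤ m := by positivity
    linarith)
  have h1 : deriv (Real.log ∘ Real.Gamma) x = deriv Real.Gamma x / Real.Gamma x :=
    (hd.hasDerivAt.log hG.ne').deriv
  have h2 := hd.hasDerivAt.ofReal_comp
  have h3 := hdc.hasDerivAt.comp_ofReal
  have h4 : (fun y : ℝ => Gamma (y:ℂ)) = fun y : ℝ => ((Real.Gamma y : ℝ) : ℂ) := by
    ext y; exact Complex.Gamma_ofReal y
  rw [h4] at h3
  have h5 := h3.unique h2
  rw [digamma_def, logDeriv_apply, h5, h1, Complex.Gamma_ofReal]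
  push_cast; rfl

theorem digamma_mono {x y : ℝ} (hx : 0 < x) (hxy : x ≤ y) :
    deriv (Real.log ∘ Real.Gamma) x ≤ deriv (Real.log ∘ Real.Gamma) y := by
  have := Real.convexOn_log_Gamma.monotoneOn_deriv (fun x hx => by
    have hd : DifferentiableAt ℝ Real.Gamma x := Real.differentiableAt_Gamma (fun m => by
      have : (0:ℝ) ≤ m := by positivity
      have : (0:ℝ) < x := hx
      linarith)
    exact hd.log (Real.Gamma_pos_of_pos hx).ne')
  exact this (by simpa using hx) (by simp; linarith) hxy

theorem digamma_shift {x : ℝ} (hx : 0 < x) (N : ℕ) : deriv (Real.log ∘ Real.Gamma) (x + N) =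
    deriv (Real.log ∘ Real.Gamma) x + ∑ k ∈ Finset.range N, 1 / (x + k) := by
  induction N with
  | zero => simp
  | succ N ih =>
    rw [Finset.sum_range_succ, ← add_assoc, ← ih]
    have hp : 0 < x + N := by positivity
    have h1 := digamma_apply_add_one ((x + N : ℝ) : ℂ) (fun m h => by
      have := congrArg Complex.re h
      simp at this
      have : (0:ℝ) ≤ m := by positivity
      linarith)
    have e : ((x + N : ℝ) : ℂ) + 1 = ((x + (N + 1 : ℕ) : ℝ) : ℂ) := by push_cast; ring
    rw [e, digamma_real hp, digamma_real (by positivity)] at h1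
    rw [one_div]
    exact_mod_cast h1

theorem digamma_one' : deriv (Real.log ∘ Real.Gamma) 1 = - Real.eulerMascheroniConstant := by
  have h := digamma_one
  have h2 := digamma_real one_pos
  rw [ofReal_one, h] at h2
  exact_mod_cast h2.symm

theorem digamma_hasSum {x : ℝ} (hx : 0 < x) :
    Tendsto (fun N : ℕ => ∑ k ∈ Finset.range N, (1 / ((k:ℝ) + 1) - 1 / (x + k + 1))) atTop
      (𝓝 (deriv (Real.log ∘ Real.Gamma) (x + 1) + Real.eulerMascheroniConstant)) := by
  obtain ⟨M, hM⟩ := exists_nat_ge x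
  have h1 : ∀ N : ℕ, ∑ k ∈ Finset.range N, (1 / ((k:ℝ) + 1) - 1 / (x + k + 1)) =
      deriv (Real.log ∘ Real.Gamma) (x + 1) + Real.eulerMascheroniConstant -
        (deriv (Real.log ∘ Real.Gamma) (x + 1 + N) - deriv (Real.log ∘ Real.Gamma) (1 + N)) := by
    intro N
    rw [digamma_shift (by linarith) N, digamma_shift one_pos N, digamma_one', Finset.sum_sub_distrib]
    have e1 : ∀ k ∈ Finset.range N, 1 / ((k:ℝ) + 1) = 1 / (1 + (k:ℝ)) := fun k _ => by rw [add_comm]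
    have e2 : ∀ k ∈ Finset.range N, 1 / (x + k + 1) = 1 / (x + 1 + (k:ℝ)) := fun k _ => by ring_nf
    rw [Finset.sum_congr rfl e1, Finset.sum_congr rfl e2]
    ring
  simp_rw [h1]
  have h2 : Tendsto (fun N : ℕ => deriv (Real.log ∘ Real.Gamma) (x + 1 + N) - deriv (Real.log ∘ Real.Gamma) (1 + N)) atTop (𝓝 0) := by
    have hb : ∀ N : ℕ, deriv (Real.log ∘ Real.Gamma) (x + 1 + N) - deriv (Real.log ∘ Real.Gamma) (1 + N) ≤
        M * (1 / ((N:ℝ) + 1)) := by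
      intro N
      have a1 := digamma_mono (x := x + 1 + N) (y := 1 + N + M) (by positivity) (by linarith)
      rw [digamma_shift (by positivity) M] at a1
      have a2 : ∑ k ∈ Finset.range M, 1 / (1 + (N:ℝ) + k) ≤ ∑ k ∈ Finset.range M, 1 / ((N:ℝ) + 1) := by
        apply Finset.sum_le_sum
        intro k _
        have : (0:ℝ) ≤ k := by positivity
        apply one_div_le_one_div_of_le (by positivity)
        linarith
      simp only [Finset.sum_const, Finset.card_range, nsmul_eq_mul] at a2
      linarith
    have hb0 : ∀ N : ℕ, 0 ≤ deriv (Real.log ∘ Real.Gamma) (x + 1 + N) - deriv (Real.log ∘ Real.Gamma) (1 + N) := by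
      intro N
      have a1 := digamma_mono (x := 1 + N) (y := x + 1 + N) (by positivity) (by linarith)
      linarith
    refine squeeze_zero hb0 hb ?_
    have := tendsto_one_div_add_atTop_nhds_zero_nat.const_mul (M:ℝ)
    simpa using this
  simpa using h2.const_sub (deriv (Real.log ∘ Real.Gamma) (x + 1) + Real.eulerMascheroniConstant)

theorem Hs_real {x : ℝ} (hx : 0 < x) :
    Hs x = digamma ((x:ℂ) / 2 + 1) / 2 - ((Real.log Real.pi / 2 : ℝ) : ℂ) := by
  have e : (x:ℂ) / 2 + 1 = ((x / 2 + 1 : ℝ) : ℂ) := by push_cast; ring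
  rw [e, digamma_real (by positivity)]
  have h1 := (hterm_summable (s := x) (by simp; linarith)).hasSum.tendsto_sum_nat
  have h2 := (digamma_hasSum (x := x / 2) (by positivity)).div_const 2
  have h3 := (continuous_ofReal.tendsto _).comp h2
  have h4 : (fun N : ℕ => ∑ n ∈ Finset.range N, hterm n x) = (ofReal ∘ fun N : ℕ => (∑ k ∈ Finset.range N, (1 / ((k:ℝ) + 1) - 1 / (x/2 + k + 1))) / 2) := by
    ext N
    simp only [Function.comp]
    push_cast
    rw [Finset.sum_div]
    apply Finset.sum_congr rfl
    intro k _
    unfold hterm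
    have a1 : (k:ℂ) + 1 ≠ 0 := by exact_mod_cast Nat.succ_ne_zero k
    have a2 := hden_ne (s := x) (by simp; linarith) k
    have a3 : (x:ℂ)/2 + k + 1 ≠ 0 := by
      intro h; apply a2; linear_combination 2 * h
    have e3 : (x:ℂ) + 2 * (k + 1) = 2 * (x/2 + k + 1) := by ring
    rw [e3]
    field_simp
  rw [h4] at h1
  have h5 := tendsto_nhds_unique h1 h3
  rw [Hs, h5]
  push_cast
  ring

theorem Hs_eq {s : ℂ} (hs : 0 < s.re) :
    Hs s = digamma (s / 2 + 1) / 2 - ((Real.log Real.pi / 2 : ℝ) : ℂ) := by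
  have ho : IsOpen {s : ℂ | 0 < s.re} := isOpen_lt continuous_const continuous_re
  have hA : AnalyticOnNhd ℂ Hs {s : ℂ | 0 < s.re} := by
    apply DifferentiableOn.analyticOnNhd _ ho
    intro w hw
    have hw' : 0 < w.re := hw
    exact (Hs_diff (by linarith)).differentiableWithinAt
  have hB : AnalyticOnNhd ℂ (fun s : ℂ => digamma (s / 2 + 1) / 2 - ((Real.log Real.pi / 2 : ℝ) : ℂ)) {s : ℂ | 0 < s.re} := by
    intro w hw
    have hw' : 0 < w.re := hw
    have hG : AnalyticAt ℂ Gamma (w/2+1) := by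
      have hop : IsOpen {s : ℂ | 0 < s.re} := ho
      refine (DifferentiableOn.analyticOnNhd (s := {s : ℂ | 0 < s.re}) ?_ ho) _ (by simp; linarith)
      intro u hu
      have hu' : 0 < u.re := hu
      exact (differentiableAt_Gamma u (fun m h => by
        have := congrArg Complex.re h
        simp at this
        have : (0:ℝ) ≤ m := by positivity
        linarith)).differentiableWithinAt
    have hdg : AnalyticAt ℂ digamma (w/2+1) := by
      rw [digamma_def]
      exact hG.deriv.div hG (Gamma_ne_zero (gamma_arg_ne (by linarith)))
    have hc : AnalyticAt ℂ (fun s : ℂ => digamma (s/2+1)) w :=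
      AnalyticAt.fun_comp (f := fun s : ℂ => s/2+1) hdg (by fun_prop)
    fun_prop
  have hc : IsPreconnected {s : ℂ | 0 < s.re} := (convex_halfSpace_re_gt 0).isPreconnected
  refine hA.eqOn_of_preconnected_of_frequently_eq hB hc (z₀ := 1) (by simp) ?_ hs
  have t : Tendsto (fun n : ℕ => ((1 + 1 / ((n:ℝ) + 1) : ℝ) : ℂ)) atTop (𝓝[≠] 1) := by
    rw [tendsto_nhdsWithin_iff]
    constructor
    · have := (tendsto_one_div_add_atTop_nhds_zero_nat (𝕜 := ℝ)).const_add 1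
      have h2 := (continuous_ofReal.tendsto _).comp this
      rw [add_zero, ofReal_one] at h2
      exact h2
    · refine Eventually.of_forall (fun n h => ?_)
      have h' : ((1 + 1 / ((n:ℝ) + 1) : ℝ) : ℂ) = ((1:ℝ):ℂ) := by rw [ofReal_one]; exact h
      have : (1 + 1 / ((n:ℝ) + 1) : ℝ) = 1 := ofReal_injective h'
      have h2 : 0 < 1 / ((n:ℝ) + 1) := by positivity
      linarith
  apply t.frequently
  apply Frequently.of_forall
  intro n
  exact Hs_real (by positivity)

/-- log derivative of `xi`. -/
theorem logDeriv_xi (RH : RiemannHypothesis) {s : ℂ} (hs : 1/2 < s.re) :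
    deriv xi s / xi s = logDeriv riemannZeta₁ s + Hs s := by
  have hpi : (Real.pi : ℂ) ≠ 0 := by exact_mod_cast Real.pi_ne_zero
  have hne1 : (Real.pi : ℂ) ^ (-s / 2) ≠ 0 := by
    rw [Ne, cpow_eq_zero_iff]; simp
  have hne2 := Gamma_ne_zero (gamma_arg_ne (s := s) (by linarith))
  have h1 : HasDerivAt (fun s : ℂ => (Real.pi : ℂ) ^ (-s / 2)) ((Real.pi : ℂ) ^ (-s / 2) * Complex.log Real.pi * (-1/2)) s := by
    have := (((hasDerivAt_id s).neg).div_const 2).const_cpow (c := (Real.pi:ℂ)) (Or.inl hpi)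
    exact this
  have h2 : HasDerivAt (fun s : ℂ => Gamma (s / 2 + 1)) (deriv Gamma (s/2+1) * (1/2)) s := by
    have := (Complex.differentiableAt_Gamma (s/2+1) (gamma_arg_ne (by linarith))).hasDerivAt
    have h3 : HasDerivAt (fun s : ℂ => s / 2 + 1) (1/2) s := ((hasDerivAt_id s).div_const 2).add_const 1
    exact HasDerivAt.comp s (h₂ := Gamma) (h := fun s : ℂ => s / 2 + 1) this h3
  have h0 := (differentiable_riemannZeta₁.differentiableAt (x := s)).hasDerivAt
  have h := h0.mul (h1.mul h2)
  have hz := zeta1_ne_zero RH hs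
  have e := h.deriv
  have e' : deriv xi s = _ := e
  rw [e', Hs_eq (by linarith), digamma_def, logDeriv_apply, logDeriv_apply, xi, Complex.ofReal_div, Complex.ofReal_log Real.pi_pos.le]
  simp only [Pi.mul_apply]
  set G := Gamma (s / 2 + 1)
  set P := (Real.pi : ℂ) ^ (-s / 2)
  set G' := deriv Gamma (s / 2 + 1)
  set Y := riemannZeta₁ s
  field_simp
  push_cast
  ring

noncomputable def Zs (s : ℂ) : ℂ := logDeriv riemannZeta₁ s

theorem re_F_nonneg (RH : RiemannHypothesis) {s : ℂ} (hs : 1/2 < s.re) : 0 ≤ (Zs s + Hs s).re := by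
  rw [Zs, ← logDeriv_xi RH hs]
  exact re_logDeriv_xi_nonneg RH hs

end ZL

end PartE

section PartF
open Complex Filter Topology Set Metric

namespace ZL

theorem Zs_diff (RH : RiemannHypothesis) {s : ℂ} (hs : 1/2 < s.re) : DifferentiableAt ℂ Zs s := by
  have h1 : Differentiable ℂ (deriv riemannZeta₁) := by
    have := differentiable_riemannZeta₁.differentiableOn.deriv isOpen_univ
    exact differentiableOn_univ.1 this
  have : Zs = fun s => deriv riemannZeta₁ s / riemannZeta₁ s := by
    ext s; rw [Zs, logDeriv_apply]
  rw [this]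
  exact h1.differentiableAt.div differentiable_riemannZeta₁.differentiableAt (zeta1_ne_zero RH hs)

theorem Zs_eq {s : ℂ} (hs : s ≠ 1) (hz : riemannZeta s ≠ 0) :
    Zs s = deriv riemannZeta s / riemannZeta s + 1 / (s - 1) := by
  have h1 : riemannZeta₁ =ᶠ[𝓝 s] fun w => (w - 1) * riemannZeta w := by
    filter_upwards [isOpen_ne.mem_nhds hs] with w hw
    exact zeta1_eq hw
  have h2 : HasDerivAt (fun w => (w - 1) * riemannZeta w) (1 * riemannZeta s + (s - 1) * deriv riemannZeta s) s :=
    ((hasDerivAt_id s).sub_const 1).mul (differentiableAt_riemannZeta hs).hasDerivAt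
  rw [Zs, logDeriv_apply, h1.deriv_eq, h2.deriv, zeta1_eq hs]
  have : s - 1 ≠ 0 := sub_ne_zero.2 hs
  field_simp
  ring

/-- von Mangoldt term. -/
noncomputable def vm (n : ℕ) : ℝ := ArithmeticFunction.vonMangoldt n

theorem vm_nonneg (n : ℕ) : 0 ≤ vm n := ArithmeticFunction.vonMangoldt_nonneg
theorem vm_zero : vm 0 = 0 := by simp [vm]

theorem vm_hasSum {s : ℂ} (hs : 1 < s.re) :
    HasSum (fun n : ℕ => (vm n : ℂ) * (n : ℂ) ^ (-s)) (1 / (s - 1) - Zs s) := by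
  have h1 := (ArithmeticFunction.LSeriesSummable_vonMangoldt hs).LSeriesHasSum
  rw [ArithmeticFunction.LSeries_vonMangoldt_eq_deriv_riemannZeta_div hs] at h1
  have hs1 : s ≠ 1 := by rintro rfl; simp at hs
  rw [Zs_eq hs1 (riemannZeta_ne_zero_of_one_lt_re hs)]
  have e : 1 / (s - 1) - (deriv riemannZeta s / riemannZeta s + 1 / (s - 1)) = -deriv riemannZeta s / riemannZeta s := by ring
  rw [e]
  have e2 : (fun n : ℕ => (vm n : ℂ) * (n : ℂ) ^ (-s)) =
      fun n => LSeries.term (fun n => ((ArithmeticFunction.vonMangoldt n : ℝ) : ℂ)) s n := by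
    ext n
    rcases eq_or_ne n 0 with rfl | hn
    · simp [vm]
    · rw [LSeries.term_of_ne_zero hn, vm, cpow_neg, div_eq_mul_inv]
  rw [e2]
  exact h1

theorem vm_norm {n : ℕ} {s : ℂ} : ‖(vm n : ℂ) * (n : ℂ) ^ (-s)‖ = vm n * (n:ℝ) ^ (-s.re) := by
  rcases Nat.eq_zero_or_pos n with rfl | hn
  · simp [vm_zero]
  · rw [norm_mul, Complex.norm_real, Real.norm_eq_abs, abs_of_nonneg (vm_nonneg n), norm_natCast_cpow_of_pos hn]
    simp

theorem vm_summable {σ : ℝ} (hσ : 1 < σ) : Summable (fun n : ℕ => vm n * (n:ℝ) ^ (-σ)) := by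
  have := (vm_hasSum (s := σ) (by simpa using hσ)).summable.norm
  simpa only [vm_norm, ofReal_re] using this

theorem Zs_bdd : ∃ K : ℝ, 0 < K ∧ ∀ s : ℂ, 2 ≤ s.re → ‖Zs s‖ ≤ K := by
  have h0 : 0 ≤ ∑' n : ℕ, vm n * (n:ℝ) ^ (-2 : ℝ) := tsum_nonneg (fun n => mul_nonneg (vm_nonneg n) (by positivity))
  refine ⟨1 + ∑' n : ℕ, vm n * (n:ℝ) ^ (-2 : ℝ), by positivity, ?_⟩
  intro s hs
  have h1 := (vm_hasSum (s := s) (by linarith)).tsum_eq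
  have h2 := tsum_of_norm_bounded (f := fun n : ℕ => (vm n : ℂ) * (n : ℂ) ^ (-s)) (vm_summable (σ := 2) (by norm_num)).hasSum (by
    intro n
    rw [vm_norm]
    rcases Nat.eq_zero_or_pos n with rfl | hn
    · simp [vm_zero]
    · apply mul_le_mul_of_nonneg_left _ (vm_nonneg n)
      apply Real.rpow_le_rpow_of_exponent_le (by exact_mod_cast hn) (by linarith))
  rw [h1] at h2
  have h3 : Zs s = 1 / (s - 1) - (1 / (s - 1) - Zs s) := by ring
  rw [h3]
  refine (norm_sub_le _ _).trans (add_le_add ?_ h2)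
  rw [norm_div, norm_one]
  have h4 : 1 ≤ ‖s - 1‖ := by
    have := (abs_le.1 (abs_re_le_norm (s-1))).2
    simp at this; linarith
  rw [div_le_one (by linarith)]
  exact h4

theorem sqrt_add_le (a b : ℝ) (ha : 0 ≤ a) (hb : 0 ≤ b) : Real.sqrt (a + b) ≤ Real.sqrt a + Real.sqrt b := by
  apply Real.sqrt_le_iff.2 ⟨by positivity, _⟩
  nlinarith [Real.sq_sqrt ha, Real.sq_sqrt hb, Real.sqrt_nonneg a, Real.sqrt_nonneg b]

theorem Zs_growth (RH : RiemannHypothesis) {δ : ℝ} (hδ : 0 < δ) :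
    ∃ C : ℝ, 0 < C ∧ ∀ s : ℂ, 1/2 + δ ≤ s.re → ‖Zs s‖ ≤ C * (1 + Real.sqrt ‖s‖) := by
  obtain ⟨K, hK, hKb⟩ := Zs_bdd
  obtain ⟨A, hA, hAb⟩ := Hs_growth
  refine ⟨K + A + (3 + 3 * (K + 3 * A)) / δ, by positivity, ?_⟩
  intro s hs
  have hq := Real.sqrt_nonneg ‖s‖
  have hpos : 0 ≤ (3 + 3 * (K + 3 * A)) / δ := by positivity
  rcases le_total 2 s.re with h2 | h2
  · refine (hKb s h2).trans ?_
    nlinarith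
  set c : ℂ := 2 + s.im * I with hc
  have hsc : ‖s - c‖ = 2 - s.re := by
    have : s - c = ((s.re - 2 : ℝ) : ℂ) := by
      apply Complex.ext <;> simp [c]
    rw [this, Complex.norm_real, Real.norm_eq_abs, abs_of_nonpos (by linarith)]
    ring
  have hre : ∀ u ∈ ball (0:ℂ) (3/2), 1/2 < (u + c).re := by
    intro u hu
    have h3 := (abs_le.1 (abs_re_le_norm u)).1
    rw [mem_ball_zero_iff] at hu
    simp [c]
    linarith
  have hBC := Complex.borelCaratheodory (f := fun u => -(Zs (u + c) + Hs (u + c))) (z := s - c) one_pos (R := 3/2)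
    (by
      intro u hu
      have h3 := hre u hu
      have a1 := (Zs_diff RH h3).add (Hs_diff (s := u + c) (by linarith))
      have a2 : HasDerivAt (fun u => (Zs + Hs) (u + c)) _ u := (a1.hasDerivAt).comp_add_const u c
      exact a2.neg.differentiableAt.differentiableWithinAt)
    (by
      intro u hu
      have := re_F_nonneg RH (hre u hu)
      change (-(Zs (u + c) + Hs (u + c))).re ≤ 1
      rw [neg_re]
      linarith) (by norm_num) (by rw [mem_ball_zero_iff, hsc]; linarith)
  simp only [sub_add_cancel, zero_add, norm_neg, hsc] at hBC
  have hcn : ‖c‖ ≤ ‖s‖ + 2 := by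
    have : c = s - (s - c) := by ring
    have h3 := norm_sub_le s (s - c)
    rw [← this] at h3
    linarith
  have hsq : Real.sqrt ‖c‖ ≤ Real.sqrt ‖s‖ + 2 := by
    have h3 := Real.sqrt_le_sqrt hcn
    have h4 := sqrt_add_le ‖s‖ 2 (norm_nonneg _) (by norm_num)
    have h5 : Real.sqrt 2 ≤ 2 := Real.sqrt_le_iff.2 (by norm_num)
    linarith
  have hFc : ‖Zs c + Hs c‖ ≤ K + A * (3 + Real.sqrt ‖s‖) := by
    refine (norm_add_le _ _).trans (add_le_add (hKb c (by simp [c])) ((hAb c (by simp [c])).trans ?_))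
    apply mul_le_mul_of_nonneg_left _ hA.le
    linarith
  have hFs : ‖Zs s + Hs s‖ ≤ (3 + 3 * (K + A * (3 + Real.sqrt ‖s‖))) / δ := by
    refine hBC.trans ?_
    rw [← add_div]
    apply div_le_div₀ (by positivity) _ hδ (by linarith)
    apply add_le_add
    · linarith
    · have hp : 0 ≤ K + A * (3 + Real.sqrt ‖s‖) := by positivity
      nlinarith [norm_nonneg (Zs c + Hs c)]
  have h6 : Zs s = (Zs s + Hs s) - Hs s := by ring
  rw [h6]
  refine (norm_sub_le _ _).trans ((add_le_add hFs (hAb s (by linarith))).trans ?_)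
  have h7 : (3 + 3 * (K + A * (3 + Real.sqrt ‖s‖))) / δ ≤ (3 + 3 * (K + 3 * A)) / δ * (1 + Real.sqrt ‖s‖) := by
    rw [div_mul_eq_mul_div]
    gcongr
    nlinarith [mul_nonneg hA.le hq, mul_nonneg hK.le hq]
  nlinarith

end ZL

end PartF

section PartG1
open Complex Filter Topology Set Metric

namespace ZL

noncomputable def Iz (L : ℝ) (κ z : ℂ) : ℂ := -dslope (fun w : ℂ => Complex.exp (-w * L)) κ z

theorem Iz_mul (L : ℝ) (κ z : ℂ) : (κ - z) * Iz L κ z = Complex.exp (-z * L) - Complex.exp (-κ * L) := by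
  have := sub_smul_dslope (fun w : ℂ => Complex.exp (-w * L)) κ z
  rw [smul_eq_mul] at this
  rw [Iz, ← this]; ring

theorem expL_deriv (L : ℝ) (w : ℂ) : HasDerivAt (fun w : ℂ => Complex.exp (-w * L)) (Complex.exp (-w * L) * (-L)) w := by
  have h : HasDerivAt (fun w : ℂ => -w * (L:ℂ)) (-L) w := by
    simpa using ((hasDerivAt_id w).neg).mul_const (L:ℂ)
  exact h.cexp

theorem Iz_diff (L : ℝ) (κ : ℂ) : Differentiable ℂ (Iz L κ) := by
  unfold Iz
  apply Differentiable.neg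
  rw [← differentiableOn_univ]
  rw [Complex.differentiableOn_dslope univ_mem]
  exact fun w _ => (expL_deriv L w).differentiableAt.differentiableWithinAt

theorem Iz_self (L : ℝ) (κ : ℂ) : Iz L κ κ = L * Complex.exp (-κ * L) := by
  rw [Iz, dslope_same, (expL_deriv L κ).deriv]; ring

theorem Iz_of_ne (L : ℝ) {κ z : ℂ} (h : κ - z ≠ 0) :
    Iz L κ z = (Complex.exp (-z * L) - Complex.exp (-κ * L)) / (κ - z) := by
  rw [← Iz_mul]; field_simp

theorem Iz_conj (L : ℝ) (κ z : ℂ) : Iz L ((starRingEnd ℂ) κ) ((starRingEnd ℂ) z) = (starRingEnd ℂ) (Iz L κ z) := by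
  rcases eq_or_ne (κ - z) 0 with h | h
  · have : κ = z := sub_eq_zero.1 h
    subst this
    rw [Iz_self, Iz_self, map_mul, ← Complex.exp_conj]
    simp
  · have h2 : (starRingEnd ℂ) κ - (starRingEnd ℂ) z ≠ 0 := by
      rw [← map_sub]; exact (map_ne_zero _).2 h
    rw [Iz_of_ne L h, Iz_of_ne L h2, map_div₀, map_sub, map_sub, ← Complex.exp_conj, ← Complex.exp_conj]
    simp

theorem norm_expL (L : ℝ) (z : ℂ) : ‖Complex.exp (-z * L)‖ = Real.exp (-(z.re * L)) := by
  rw [Complex.norm_exp]; simp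

theorem Iz_bound {L r : ℝ} (hL : 0 < L) {κ z : ℂ} (h1 : r ≤ κ.re) (h2 : r ≤ z.re) :
    ‖Iz L κ z‖ ≤ L * Real.exp (-(r * L)) := by
  rcases eq_or_ne (κ - z) 0 with h | h
  · have : κ = z := sub_eq_zero.1 h
    subst this
    rw [Iz_self, norm_mul, norm_expL, Complex.norm_real, Real.norm_eq_abs, abs_of_pos hL]
    gcongr
  · rw [Iz_of_ne L h, norm_div, div_le_iff₀ (norm_pos_iff.2 h), norm_sub_rev κ z]
    refine (convex_halfSpace_re_ge r).norm_image_sub_le_of_norm_hasDerivWithin_le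
      (f := fun w : ℂ => Complex.exp (-w * L)) (f' := fun w => Complex.exp (-w * L) * (-L))
      (fun w _ => (expL_deriv L w).hasDerivWithinAt) ?_ h1 h2
    intro w hw
    have hw' : r ≤ w.re := hw
    rw [norm_mul, norm_expL, norm_neg, Complex.norm_real, Real.norm_eq_abs, abs_of_pos hL, mul_comm]
    gcongr

theorem Iz_bound2 {L : ℝ} (hL : 0 < L) {κ z : ℂ} (h1 : 0 < κ.re) (h2 : 0 ≤ z.re) :
    ‖Iz L κ z‖ ≤ 4 / κ.re := by
  rcases le_total (κ.re / 2) z.re with h | h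
  · refine (Iz_bound hL (r := κ.re / 2) (by linarith) h).trans ?_
    rw [Real.exp_neg, ← div_eq_mul_inv, div_le_div_iff₀ (Real.exp_pos _) h1]
    have := Real.add_one_le_exp (κ.re / 2 * L)
    nlinarith
  · have hne : κ - z ≠ 0 := by
      intro h0
      have := congrArg Complex.re h0
      simp at this
      linarith
    rw [Iz_of_ne L hne, norm_div, div_le_div_iff₀ (norm_pos_iff.2 hne) h1]
    have a1 : κ.re / 2 ≤ ‖κ - z‖ := by
      have := (abs_le.1 (abs_re_le_norm (κ - z))).2
      simp at this; linarith
    have a2 : ‖Complex.exp (-z * L) - Complex.exp (-κ * L)‖ ≤ 2 := by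
      refine (norm_sub_le _ _).trans ?_
      rw [norm_expL, norm_expL]
      have b1 : Real.exp (-(z.re * L)) ≤ 1 := Real.exp_le_one_iff.2 (by nlinarith)
      have b2 : Real.exp (-(κ.re * L)) ≤ 1 := Real.exp_le_one_iff.2 (by nlinarith)
      linarith
    nlinarith

/-- coefficients -/
noncomputable def an (p : ℂ) (n : ℕ) : ℂ := (vm n : ℂ) * (n : ℂ) ^ (-(1/2 + p))

noncomputable def ell (L : ℝ) (n : ℕ) : ℝ := L - Real.log n

noncomputable def Sx (L : ℝ) : Finset ℕ := Finset.range (⌊Real.exp L⌋₊ + 1)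

theorem mem_Sx {L : ℝ} {n : ℕ} : n ∈ Sx L ↔ (n : ℝ) ≤ Real.exp L := by
  rw [Sx, Finset.mem_range, Nat.lt_succ_iff, Nat.le_floor_iff (Real.exp_pos L).le]

theorem ell_neg {L : ℝ} {n : ℕ} (hn : n ∉ Sx L) : ell L n ≤ 0 := by
  rw [mem_Sx] at hn
  push Not at hn
  have := Real.log_le_log (Real.exp_pos L) hn.le
  rw [Real.log_exp] at this
  unfold ell; linarith

/-- regularised zeta part -/
noncomputable def VZ (L : ℝ) (p z : ℂ) : ℂ :=
  Complex.exp (z * L) * Zs (1/2 + p + z)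
    + ∑ n ∈ Sx L, (an p n * Complex.exp (z * ell L n) - (starRingEnd ℂ) (an p n) * Complex.exp (-(z * ell L n)))
    - (Iz L (p - 1/2) (-z) - Iz L ((starRingEnd ℂ) (p - 1/2)) z)

theorem VZ_diff (RH : RiemannHypothesis) (L : ℝ) {p z : ℂ} (hz : 0 < p.re + z.re) : DifferentiableAt ℂ (VZ L p) z := by
  unfold VZ
  have h1 : DifferentiableAt ℂ (fun z => Zs (1/2 + p + z)) z := by
    apply DifferentiableAt.comp (g := Zs) (f := fun z : ℂ => 1/2 + p + z) z (Zs_diff RH _) (by fun_prop)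
    simp; linarith
  have h2 : DifferentiableAt ℂ (fun z => Iz L (p - 1/2) (-z)) z :=
    DifferentiableAt.comp (g := Iz L (p-1/2)) (f := fun z : ℂ => -z) z (Iz_diff L _).differentiableAt (by fun_prop)
  have h3 : DifferentiableAt ℂ (fun z => Iz L ((starRingEnd ℂ) (p - 1/2)) z) z := (Iz_diff L _).differentiableAt
  have h4 : DifferentiableAt ℂ (fun z : ℂ => Complex.exp (z * L)) z := by fun_prop
  have h5 : DifferentiableAt ℂ (fun z : ℂ => ∑ n ∈ Sx L, (an p n * Complex.exp (z * ell L n) - (starRingEnd ℂ) (an p n) * Complex.exp (-(z * ell L n)))) z := by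
    apply DifferentiableAt.fun_sum
    intro n _
    fun_prop
  exact ((h4.mul h1).add h5).sub (h2.sub h3)

theorem conj_yI (y : ℝ) : (starRingEnd ℂ) ((y:ℂ) * I) = -(y * I) := by simp

theorem VZ_boundary (L : ℝ) (p : ℂ) (y : ℝ) :
    (VZ L p (y * I)).re = (Complex.exp (y * I * L) * Zs (1/2 + p + y * I)).re := by
  unfold VZ
  rw [sub_re, add_re, re_sum]
  have h1 : ∀ n ∈ Sx L, (an p n * Complex.exp (y * I * ell L n) - (starRingEnd ℂ) (an p n) * Complex.exp (-(y * I * ell L n))).re = 0 := by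
    intro n _
    have : (starRingEnd ℂ) (an p n) * Complex.exp (-(y * I * ell L n)) = (starRingEnd ℂ) (an p n * Complex.exp (y * I * ell L n)) := by
      rw [map_mul, ← Complex.exp_conj]
      congr 2
      rw [map_mul, conj_yI, Complex.conj_ofReal]; ring
    rw [this]
    simp
  rw [Finset.sum_eq_zero h1]
  have h2 : Iz L ((starRingEnd ℂ) (p - 1/2)) (y * I) = (starRingEnd ℂ) (Iz L (p - 1/2) (-(y * I))) := by
    rw [← Iz_conj, map_neg, conj_yI, neg_neg]
  rw [h2]
  simp

theorem an_term (L : ℝ) (p z : ℂ) (n : ℕ) :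
    an p n * Complex.exp (z * ell L n) = Complex.exp (z * L) * ((vm n : ℂ) * (n:ℂ) ^ (-(1/2 + p + z))) := by
  rcases Nat.eq_zero_or_pos n with rfl | hn
  · simp [an, vm_zero]
  · have hn0 : (n:ℂ) ≠ 0 := by exact_mod_cast hn.ne'
    have e : -(1/2 + p + z) = -(1/2 + p) + -z := by ring
    rw [an, e, cpow_add _ _ hn0]
    have : Complex.exp (z * ell L n) = Complex.exp (z * L) * (n:ℂ) ^ (-z) := by
      rw [cpow_def_of_ne_zero hn0, ← Complex.exp_add, ell, ← Complex.natCast_log]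
      congr 1
      push_cast; ring
    rw [this]; ring

theorem sqrt_shift (a z : ℂ) : Real.sqrt ‖a + z‖ ≤ Real.sqrt ‖a‖ + Real.sqrt ‖z‖ :=
  (Real.sqrt_le_sqrt (norm_add_le _ _)).trans (sqrt_add_le _ _ (norm_nonneg _) (norm_nonneg _))

theorem VZ_growth (RH : RiemannHypothesis) {L : ℝ} (hL : 0 < L) {p : ℂ} (hp : 0 < p.re) :
    ∃ C : ℝ, 0 ≤ C ∧ ∀ z : ℂ, 0 ≤ z.re → ‖VZ L p z‖ ≤ C * (1 + Real.sqrt ‖z‖) := by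
  obtain ⟨A, hA, hAb⟩ := Zs_growth RH hp
  set g : ℕ → ℝ := fun n => ‖an p n‖ * Real.exp (2 * |ell L n|) with hg
  have hg0 : ∀ n, 0 ≤ g n := fun n => by positivity
  set K1 := ∑ n ∈ Sx L, ‖an p n‖ with hK1
  have hK10 : 0 ≤ K1 := Finset.sum_nonneg (fun n _ => norm_nonneg _)
  set K2 := ∑ n ∈ Sx L, g n with hK2
  have hK20 : 0 ≤ K2 := Finset.sum_nonneg (fun n _ => hg0 n)
  have hsum : Summable (fun n : ℕ => vm n * (n:ℝ) ^ (-(2:ℝ))) := vm_summable (by norm_num)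
  set K3 := ∑' n : ((Sx L : Set ℕ)ᶜ : Set ℕ), vm n * ((n : ℕ) : ℝ) ^ (-(2:ℝ)) with hK3
  have hK30 : 0 ≤ K3 := tsum_nonneg (fun n => mul_nonneg (vm_nonneg _) (by positivity))
  set M := Real.exp (2 * L) with hM
  have hM0 : 0 < M := Real.exp_pos _
  set q := Real.sqrt ‖1/2 + p‖ with hq
  have hq0 : 0 ≤ q := Real.sqrt_nonneg _
  -- bounds for the pieces common to both cases
  have hneg : ∀ z : ℂ, 0 ≤ z.re → ‖∑ n ∈ Sx L, (starRingEnd ℂ) (an p n) * Complex.exp (-(z * ell L n))‖ ≤ K1 := by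
    intro z hz
    refine norm_sum_le_of_le _ (fun n hn => ?_)
    rw [norm_mul, RCLike.norm_conj, Complex.norm_exp]
    rcases Nat.eq_zero_or_pos n with rfl | hn0
    · simp [an, vm_zero]
    have hl : 0 ≤ ell L n := by
      rw [mem_Sx] at hn
      have := Real.log_le_log (by exact_mod_cast hn0) hn
      rw [Real.log_exp] at this
      unfold ell; linarith
    have : Real.exp (-(z * ell L n)).re ≤ 1 := by
      apply Real.exp_le_one_iff.2
      simp; positivity
    nlinarith [norm_nonneg (an p n)]
  have hI1 : ∀ z : ℂ, 0 ≤ z.re → ‖Iz L ((starRingEnd ℂ) (p - 1/2)) z‖ ≤ L * M := by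
    intro z hz
    refine (Iz_bound hL (r := -2) (by simp; linarith) (by linarith)).trans ?_
    rw [hM]; gcongr; linarith
  have hexpand : ∀ z : ℂ, VZ L p z = (Complex.exp (z * L) * Zs (1/2 + p + z) + ∑ n ∈ Sx L, an p n * Complex.exp (z * ell L n) - Iz L (p - 1/2) (-z))
      - ∑ n ∈ Sx L, (starRingEnd ℂ) (an p n) * Complex.exp (-(z * ell L n)) + Iz L ((starRingEnd ℂ) (p - 1/2)) z := by
    intro z
    rw [VZ, Finset.sum_sub_distrib]; ring
  refine ⟨K1 + L * M + (M * (A * (1 + q)) + K2 + L * M) + (M + M * K3), by positivity, ?_⟩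
  intro z hz
  have hsz := Real.sqrt_nonneg ‖z‖
  rw [hexpand]
  have hmain : ‖Complex.exp (z * L) * Zs (1/2 + p + z) + ∑ n ∈ Sx L, an p n * Complex.exp (z * ell L n) - Iz L (p - 1/2) (-z)‖
      ≤ (M * (A * (1 + q)) + K2 + L * M) * (1 + Real.sqrt ‖z‖) + (M + M * K3) := by
    rcases le_total z.re 2 with h2 | h2
    · have b1 : ‖Complex.exp (z * L) * Zs (1/2 + p + z)‖ ≤ M * (A * (1 + q)) * (1 + Real.sqrt ‖z‖) := by
        rw [norm_mul, mul_assoc]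
        have c1 : ‖Complex.exp (z * L)‖ ≤ M := by
          rw [Complex.norm_exp, hM]
          apply Real.exp_le_exp.2
          simp; nlinarith
        have c2 : ‖Zs (1/2 + p + z)‖ ≤ A * (1 + q) * (1 + Real.sqrt ‖z‖) := by
          refine (hAb _ (by simp; linarith)).trans ?_
          rw [mul_assoc]
          apply mul_le_mul_of_nonneg_left _ hA.le
          have := sqrt_shift (1/2 + p) z
          nlinarith
        gcongr
      have b2 : ‖∑ n ∈ Sx L, an p n * Complex.exp (z * ell L n)‖ ≤ K2 := by
        refine norm_sum_le_of_le _ (fun n hn => ?_)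
        rw [norm_mul, Complex.norm_exp]
        apply mul_le_mul_of_nonneg_left _ (norm_nonneg _)
        apply Real.exp_le_exp.2
        have d1 : (z * ell L n).re = z.re * ell L n := by simp
        rw [d1]
        nlinarith [le_abs_self (ell L n), abs_nonneg (ell L n)]
      have b3 : ‖Iz L (p - 1/2) (-z)‖ ≤ L * M := by
        refine (Iz_bound hL (r := -2) (by simp; linarith) (by simp; linarith)).trans ?_
        rw [hM]; gcongr; linarith
      refine (norm_sub_le _ _).trans ((add_le_add ((norm_add_le _ _).trans (add_le_add b1 b2)) b3).trans ?_)
      have : 0 ≤ M + M * K3 := by positivity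
      have e1 : 0 ≤ (K2 + L * M) * Real.sqrt ‖z‖ := by positivity
      nlinarith
    · have hs1 : 1 < (1/2 + p + z).re := by simp; linarith
      have hS := vm_hasSum hs1
      have hS2 : HasSum (fun n : ℕ => an p n * Complex.exp (z * ell L n)) (Complex.exp (z * L) * (1 / (1/2 + p + z - 1) - Zs (1/2 + p + z))) := by
        have := hS.mul_left (Complex.exp (z * L))
        refine this.congr_fun ?_
        intro n
        exact an_term L p z n
      have h3 := hS2.summable.sum_add_tsum_compl (s := Sx L)
      rw [hS2.tsum_eq] at h3
      have hκ : p - 1/2 - -z ≠ 0 := by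
        intro h0
        have := congrArg Complex.re h0
        simp at this
        linarith
      have e1 : Complex.exp (z * L) * Zs (1/2 + p + z) + ∑ n ∈ Sx L, an p n * Complex.exp (z * ell L n) - Iz L (p - 1/2) (-z)
          = Complex.exp (-(p - 1/2) * L) / (p - 1/2 - -z) - ∑' n : ((Sx L : Set ℕ)ᶜ : Set ℕ), an p n * Complex.exp (z * ell L n) := by
        rw [Iz_of_ne L hκ]
        have e2 : (1/2 + p + z - 1) = p - 1/2 - -z := by ring
        rw [e2] at h3
        have e3 : (- -z * (L:ℂ)) = z * L := by ring
        rw [e3]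
        linear_combination h3
      rw [e1]
      have b1 : ‖Complex.exp (-(p - 1/2) * L) / (p - 1/2 - -z)‖ ≤ M := by
        rw [norm_div, norm_expL]
        have c1 : 1 ≤ ‖p - 1/2 - -z‖ := by
          have := (abs_le.1 (abs_re_le_norm (p - 1/2 - -z))).2
          have e : (p - 1/2 - -z).re = p.re - 1/2 + z.re := by simp
          rw [e] at this; linarith
        rw [div_le_iff₀ (by linarith)]
        have c2 : Real.exp (-((p - 1/2).re * L)) ≤ M := by
          rw [hM]; apply Real.exp_le_exp.2
          simp; nlinarith
        nlinarith
      have b2 : ‖∑' n : ((Sx L : Set ℕ)ᶜ : Set ℕ), an p n * Complex.exp (z * ell L n)‖ ≤ M * K3 := by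
        apply tsum_of_norm_bounded ((hsum.subtype _).hasSum.mul_left M)
        rintro ⟨n, hn⟩
        simp only [Function.comp]
        have hn' : n ∉ Sx L := by simpa using hn
        rcases Nat.eq_zero_or_pos n with rfl | hn0
        · simp [an, vm_zero]
        have hl := ell_neg hn'
        rw [norm_mul, an, vm_norm, Complex.norm_exp]
        have d1 : (z * ell L n).re = z.re * ell L n := by simp
        rw [d1]
        have hn1 : (1:ℝ) ≤ n := by exact_mod_cast hn0
        have d2 : Real.exp (z.re * ell L n) ≤ M * (n:ℝ) ^ (-(2:ℝ)) := by
          rw [hM, Real.rpow_def_of_pos (by linarith), ← Real.exp_add]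
          apply Real.exp_le_exp.2
          unfold ell at *
          nlinarith
        have d3 : (n:ℝ) ^ (-(1/2 + p).re) ≤ 1 := Real.rpow_le_one_of_one_le_of_nonpos hn1 (by simp; linarith)
        have d4 : 0 ≤ M * (n:ℝ) ^ (-(2:ℝ)) := by positivity
        calc vm n * (n:ℝ) ^ (-(1/2 + p).re) * Real.exp (z.re * ell L n) ≤ vm n * 1 * (M * (n:ℝ) ^ (-(2:ℝ))) := by
              have := vm_nonneg n
              gcongr
          _ = M * (vm n * (n:ℝ) ^ (-(2:ℝ))) := by ring
      refine (norm_sub_le _ _).trans ((add_le_add b1 b2).trans ?_)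
      have : 0 ≤ (M * (A * (1 + q)) + K2 + L * M) * (1 + Real.sqrt ‖z‖) := by positivity
      linarith
  refine (norm_add_le _ _).trans ((add_le_add ((norm_sub_le _ _).trans (add_le_add hmain (hneg z hz))) (hI1 z hz)).trans ?_)
  have e1 : 0 ≤ (K1 + L * M + (M + M * K3)) * Real.sqrt ‖z‖ := by positivity
  nlinarith

end ZL

end PartG1

section PartG2
open Complex Filter Topology Set Metric

namespace ZL

noncomputable def kap (p : ℂ) (n : ℕ) : ℂ := p + 1/2 + 2 * ((n:ℂ) + 1)

noncomputable def qn (L : ℝ) (p : ℂ) (n : ℕ) (z : ℂ) : ℂ :=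
  Complex.exp (-z * L) / (2 * ((n:ℂ) + 1)) - Complex.exp (-kap p n * L) / (z + kap p n)
    - Iz L ((starRingEnd ℂ) (kap p n)) z

noncomputable def CH : ℝ := Real.eulerMascheroniConstant / 2 + Real.log Real.pi / 2

noncomputable def VH (L : ℝ) (p z : ℂ) : ℂ := ∑' n, qn L p n z - (CH : ℂ) * Complex.exp (-z * L)

theorem conj_two : (starRingEnd ℂ) (2:ℂ) = 2 := map_ofNat _ 2

theorem kap_re (p : ℂ) (n : ℕ) : (kap p n).re = p.re + 1/2 + 2 * ((n:ℝ) + 1) := by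
  simp [kap]

theorem kap_re_ge {p : ℂ} (hp : 0 < p.re) (n : ℕ) : 2 * ((n:ℝ) + 1) ≤ (kap p n).re := by
  rw [kap_re]; linarith

theorem zkap_norm {p z : ℂ} (hp : 0 < p.re) (hz : 0 ≤ z.re) (n : ℕ) : 2 * ((n:ℝ) + 1) ≤ ‖z + kap p n‖ := by
  have := (abs_le.1 (abs_re_le_norm (z + kap p n))).2
  rw [add_re] at this
  linarith [kap_re_ge hp n]

theorem rpow_m32 {m : ℝ} (hm : 0 < m) : m ^ (-3/2 : ℝ) = 1 / (m * Real.sqrt m) := by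
  rw [Real.sqrt_eq_rpow, ← Real.rpow_one_add' hm.le (by norm_num), one_div, ← Real.rpow_neg hm.le]
  norm_num

theorem qn_bound {L : ℝ} (hL : 0 < L) {p : ℂ} (hp : 0 < p.re) :
    ∃ C : ℝ, 0 ≤ C ∧ ∀ z : ℂ, 0 ≤ z.re → ∀ n, ‖qn L p n z‖ ≤ C * (1 + Real.sqrt ‖z‖) * ((n:ℝ) + 1) ^ (-3/2 : ℝ) := by
  set a := ‖p + 1/2‖ with ha
  have ha0 : 0 ≤ a := norm_nonneg _
  set B := 4 * (a + 1) + 2 with hB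
  have hB0 : 0 ≤ B := by positivity
  refine ⟨a + 1 / L + Real.sqrt (2 * B), by positivity, ?_⟩
  intro z hz n
  set m : ℝ := (n:ℝ) + 1 with hm
  have hm1 : 1 ≤ m := by rw [hm]; linarith [(Nat.cast_nonneg n : (0:ℝ) ≤ n)]
  have hmC : ((n:ℂ) + 1) = (m:ℂ) := by rw [hm]; push_cast; ring
  set κ := kap p n with hκ
  set κ' := (starRingEnd ℂ) κ with hκ'
  have hκre : 2 * m ≤ κ.re := kap_re_ge hp n
  have hκ're : κ'.re = κ.re := Complex.conj_re _
  have hκn : 2 * m ≤ ‖κ'‖ := by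
    have := (abs_le.1 (abs_re_le_norm κ')).2
    linarith
  have hκ0 : κ' ≠ 0 := norm_pos_iff.1 (by linarith)
  have hm0 : (m:ℂ) ≠ 0 := by exact_mod_cast (by linarith : m ≠ 0)
  have hzκ : 2 * m ≤ ‖z + κ‖ := zkap_norm hp hz n
  set J := Iz L κ' z with hJ
  have hJ2 : ‖J‖ ≤ 4 / κ.re := by
    rw [hJ, ← hκ're]; exact Iz_bound2 hL (by linarith) hz
  have hIm := Iz_mul L κ' z
  rw [← hJ] at hIm
  have hq : qn L p n z = Complex.exp (-z * L) * (1 / (2 * (m:ℂ)) - 1 / κ') + Complex.exp (-κ' * L) / κ'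
      - z * J / κ' - Complex.exp (-κ * L) / (z + κ) := by
    rw [qn, ← hκ, ← hκ', ← hJ, hmC]
    have : J = (Complex.exp (-z * L) - Complex.exp (-κ' * L) + z * J) / κ' := by
      rw [eq_div_iff hκ0, ← hIm]; ring
    nth_rewrite 1 [this]
    ring
  have hκa : ‖κ'‖ ≤ a + 2 * m := by
    rw [hκ', RCLike.norm_conj, hκ, kap, hmC]
    refine (norm_add_le _ _).trans ?_
    rw [norm_mul, Complex.norm_real, Real.norm_eq_abs, abs_of_pos (by linarith)]
    simp [ha]
  have hez : ‖Complex.exp (-z * L)‖ ≤ 1 := by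
    rw [norm_expL]; exact Real.exp_le_one_iff.2 (by nlinarith)
  have hek : Real.exp (-(κ.re * L)) ≤ 1 / (2 * m * L) := by
    rw [Real.exp_neg, inv_eq_one_div]
    apply one_div_le_one_div_of_le (by positivity)
    have := Real.add_one_le_exp (κ.re * L)
    nlinarith
  have hek1 : ‖Complex.exp (-κ * L)‖ ≤ 1 / (2 * m * L) := by rw [norm_expL]; exact hek
  have hek2 : ‖Complex.exp (-κ' * L)‖ ≤ 1 / (2 * m * L) := by rw [norm_expL, hκ're]; exact hek
  have hek3 : ‖Complex.exp (-κ' * L)‖ ≤ 1 := by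
    rw [norm_expL]; exact Real.exp_le_one_iff.2 (by rw [hκ're]; nlinarith)
  have t1 : ‖Complex.exp (-z * L) * (1 / (2 * (m:ℂ)) - 1 / κ')‖ ≤ a / (4 * m ^ 2) := by
    rw [norm_mul]
    have e : 1 / (2 * (m:ℂ)) - 1 / κ' = (κ' - 2 * m) / (2 * m * κ') := by field_simp
    have e2 : κ' - 2 * m = (starRingEnd ℂ) (p + 1/2) := by
      rw [hκ', hκ, kap, hmC, map_add, map_mul, Complex.conj_ofReal, conj_two]
      ring
    rw [e, e2, norm_div, RCLike.norm_conj, ← ha, norm_mul, norm_mul, Complex.norm_real, Real.norm_eq_abs, abs_of_pos (by linarith)]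
    have : a / (‖(2:ℂ)‖ * m * ‖κ'‖) ≤ a / (4 * m ^ 2) := by
      apply div_le_div_of_nonneg_left ha0 (by positivity)
      simp; nlinarith
    calc _ ≤ 1 * (a / (4 * m ^ 2)) := by gcongr
      _ = _ := one_mul _
  have t2 : ‖Complex.exp (-κ' * L) / κ'‖ ≤ 1 / (2 * m * L) / (2 * m) := by
    rw [norm_div]; gcongr
  have t4 : ‖Complex.exp (-κ * L) / (z + κ)‖ ≤ 1 / (2 * m * L) / (2 * m) := by
    rw [norm_div]; gcongr
  have hzJ1 : ‖z * J‖ ≤ B := by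
    have : z * J = κ' * J - (Complex.exp (-z * L) - Complex.exp (-κ' * L)) := by rw [← hIm]; ring
    rw [this]
    have h1 : ‖κ' * J‖ ≤ 4 * (a + 1) := by
      rw [norm_mul]
      calc ‖κ'‖ * ‖J‖ ≤ (a + 2 * m) * (4 / (2 * m)) := by
            gcongr
            exact hJ2.trans (div_le_div_of_nonneg_left (by norm_num) (by linarith) hκre)
        _ = 2 * a / m + 4 := by field_simp; ring
        _ ≤ 2 * a + 4 := by
            have : 2 * a / m ≤ 2 * a := div_le_self (by linarith) hm1
            linarith
        _ ≤ _ := by linarith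
    have h2 : ‖Complex.exp (-z * L) - Complex.exp (-κ' * L)‖ ≤ 2 := (norm_sub_le _ _).trans (by linarith)
    refine (norm_sub_le _ _).trans (by rw [hB]; linarith)
  have hzJ2 : ‖z * J‖ ≤ 2 * ‖z‖ / m := by
    rw [norm_mul]
    have : ‖J‖ ≤ 4 / (2 * m) := hJ2.trans (div_le_div_of_nonneg_left (by norm_num) (by linarith) hκre)
    calc ‖z‖ * ‖J‖ ≤ ‖z‖ * (4 / (2 * m)) := by gcongr
      _ = _ := by field_simp; ring
  have hzJ : ‖z * J‖ ≤ Real.sqrt (2 * B) * Real.sqrt ‖z‖ / Real.sqrt m := by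
    rw [← Real.sqrt_mul (by positivity), ← Real.sqrt_div (by positivity)]
    apply Real.le_sqrt_of_sq_le
    calc ‖z * J‖ ^ 2 = ‖z * J‖ * ‖z * J‖ := sq _
      _ ≤ B * (2 * ‖z‖ / m) := by gcongr
      _ = _ := by ring
  have t3 : ‖z * J / κ'‖ ≤ Real.sqrt (2 * B) * Real.sqrt ‖z‖ / Real.sqrt m / (2 * m) := by
    rw [norm_div]; gcongr
  rw [hq, rpow_m32 (by linarith)]
  refine (norm_sub_le _ _).trans ((add_le_add ((norm_sub_le _ _).trans (add_le_add ((norm_add_le _ _).trans (add_le_add t1 t2)) t3)) t4).trans ?_)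
  set s := Real.sqrt m with hs
  have hs1 : 1 ≤ s := Real.one_le_sqrt.2 hm1
  have hsm : m = s ^ 2 := (Real.sq_sqrt (by linarith)).symm
  rw [hsm]
  set w := Real.sqrt ‖z‖
  have hw : 0 ≤ w := Real.sqrt_nonneg _
  set b := Real.sqrt (2 * B)
  have hb : 0 ≤ b := Real.sqrt_nonneg _
  have k1 : a / (4 * (s ^ 2) ^ 2) ≤ a * (1 / (s ^ 2 * s)) := by
    rw [mul_one_div]
    apply div_le_div_of_nonneg_left ha0 (by positivity)
    nlinarith [pow_pos (by linarith : 0 < s) 3]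
  have k2 : 1 / (2 * s ^ 2 * L) / (2 * s ^ 2) ≤ (1 / L) / 4 * (1 / (s ^ 2 * s)) := by
    have : 1 / (2 * s ^ 2 * L) / (2 * s ^ 2) = (1 / L) / 4 * (1 / (s ^ 2 * s)) * (1 / s) := by field_simp; norm_num
    rw [this]
    apply mul_le_of_le_one_right (by positivity)
    rw [div_le_one (by linarith)]; exact hs1
  have k3 : b * w / s / (2 * s ^ 2) = b * w / 2 * (1 / (s ^ 2 * s)) := by field_simp
  rw [k3]
  have hr : 0 ≤ 1 / (s ^ 2 * s) := by positivity
  have hLi : 0 ≤ 1 / L := by positivity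
  set r := 1 / (s ^ 2 * s)
  set l := 1 / L
  have : (a + l + b) * (1 + w) * r = a * r + l * r + b * r + a * w * r + l * w * r + b * w * r := by ring
  rw [this]
  have p1 : 0 ≤ b * r := by positivity
  have p2 : 0 ≤ a * w * r := by positivity
  have p3 : 0 ≤ l * w * r := by positivity
  have p4 : 0 ≤ b * w * r := by positivity
  have p5 : 0 ≤ l * r := by positivity
  linarith

theorem summ32 : Summable (fun n : ℕ => ((n:ℝ) + 1) ^ (-3/2 : ℝ)) := summable_shift_rpow (by norm_num)

theorem qn_summable {L : ℝ} (hL : 0 < L) {p z : ℂ} (hp : 0 < p.re) (hz : 0 ≤ z.re) : Summable (fun n => qn L p n z) := by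
  obtain ⟨C, _, h⟩ := qn_bound hL hp
  exact Summable.of_norm_bounded (summ32.mul_left (C * (1 + Real.sqrt ‖z‖))) (h z hz)

theorem VH_growth {L : ℝ} (hL : 0 < L) {p : ℂ} (hp : 0 < p.re) :
    ∃ C : ℝ, 0 ≤ C ∧ ∀ z : ℂ, 0 ≤ z.re → ‖VH L p z‖ ≤ C * (1 + Real.sqrt ‖z‖) := by
  obtain ⟨C, hC, h⟩ := qn_bound hL hp
  set K := ∑' n : ℕ, ((n:ℝ) + 1) ^ (-3/2 : ℝ)
  have hK : 0 ≤ K := tsum_nonneg (fun n => by positivity)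
  refine ⟨C * K + |CH|, by positivity, fun z hz => ?_⟩
  have h1 : ‖∑' n, qn L p n z‖ ≤ C * (1 + Real.sqrt ‖z‖) * K :=
    tsum_of_norm_bounded (summ32.hasSum.mul_left _) (h z hz)
  have hez : ‖Complex.exp (-z * L)‖ ≤ 1 := by
    rw [norm_expL]; exact Real.exp_le_one_iff.2 (by nlinarith)
  have h2 : ‖(CH : ℂ) * Complex.exp (-z * L)‖ ≤ |CH| := by
    rw [norm_mul, Complex.norm_real, Real.norm_eq_abs]
    nlinarith [abs_nonneg CH]
  refine (norm_sub_le _ _).trans ((add_le_add h1 h2).trans ?_)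
  nlinarith [mul_nonneg (abs_nonneg CH) (Real.sqrt_nonneg ‖z‖)]

theorem qn_diff (L : ℝ) {p z : ℂ} (hp : 0 < p.re) (hz : 0 ≤ z.re) (n : ℕ) : DifferentiableAt ℂ (qn L p n) z := by
  unfold qn
  have h0 : z + kap p n ≠ 0 := norm_pos_iff.1 (by linarith [zkap_norm hp hz n, (Nat.cast_nonneg n : (0:ℝ) ≤ n)])
  have h3 : DifferentiableAt ℂ (fun z => Iz L ((starRingEnd ℂ) (kap p n)) z) z := (Iz_diff L _).differentiableAt
  have h1 : DifferentiableAt ℂ (fun z : ℂ => Complex.exp (-z * L) / (2 * ((n:ℂ) + 1))) z := by fun_prop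
  have h2 : DifferentiableAt ℂ (fun z : ℂ => Complex.exp (-kap p n * L) / (z + kap p n)) z :=
    (differentiableAt_const _).div (by fun_prop) h0
  exact (h1.sub h2).sub h3

theorem closure_half : closure {z : ℂ | 0 < z.re} = {z : ℂ | 0 ≤ z.re} := by
  simp

theorem VH_diff {L : ℝ} (hL : 0 < L) {p : ℂ} (hp : 0 < p.re) : DiffContOnCl ℂ (VH L p) {z | 0 < z.re} := by
  obtain ⟨C, hC, h⟩ := qn_bound hL hp
  have hb : ∀ R : ℝ, ∀ n, ∀ z : ℂ, 0 ≤ z.re → z ∈ ball (0:ℂ) R → ‖qn L p n z‖ ≤ C * (1 + Real.sqrt R) * ((n:ℝ) + 1) ^ (-3/2 : ℝ) := by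
    intro R n z hz hzR
    refine (h z hz n).trans ?_
    have : ‖z‖ ≤ R := by simpa using (mem_ball_zero_iff.1 hzR).le
    gcongr
  have hexp : Differentiable ℂ (fun z : ℂ => (CH : ℂ) * Complex.exp (-z * L)) := by fun_prop
  have ho : IsOpen {z : ℂ | 0 < z.re} := isOpen_lt continuous_const Complex.continuous_re
  constructor
  · intro z hz
    have hz' : 0 < z.re := hz
    apply DifferentiableAt.differentiableWithinAt
    set R := ‖z‖ + 1
    have hU : IsOpen ({z : ℂ | 0 < z.re} ∩ ball 0 R) := ho.inter isOpen_ball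
    have hd := differentiableOn_tsum_of_summable_norm (summ32.mul_left (C * (1 + Real.sqrt R)))
      (fun n => fun w (hw : w ∈ {z : ℂ | 0 < z.re} ∩ ball 0 R) => (qn_diff L hp (show 0 ≤ w.re from le_of_lt hw.1) n).differentiableWithinAt) hU
      (fun n w hw => hb R n w (le_of_lt hw.1) hw.2)
    have hd' := hd.differentiableAt (hU.mem_nhds ⟨hz, by simp [R]⟩)
    exact hd'.sub hexp.differentiableAt
  · rw [closure_half]
    intro z hz
    set R := ‖z‖ + 1
    have hc := continuousOn_tsum (s := {z : ℂ | 0 ≤ z.re} ∩ ball 0 R) (f := fun n z => qn L p n z)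
      (fun n w hw => (qn_diff L hp hw.1 n).continuousAt.continuousWithinAt)
      (summ32.mul_left (C * (1 + Real.sqrt R))) (fun n w hw => hb R n w hw.1 hw.2)
    have hc' := hc z ⟨hz, by simp [R]⟩
    rw [continuousWithinAt_inter (isOpen_ball.mem_nhds (by simp [R]))] at hc'
    exact hc'.sub hexp.continuous.continuousAt.continuousWithinAt

theorem qn_boundary (L : ℝ) {p : ℂ} (hp : 0 < p.re) (y : ℝ) (n : ℕ) :
    (qn L p n (y * I)).re = (Complex.exp (y * I * L) * hterm n (1/2 + p + y * I)).re := by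
  have h0 : y * I + kap p n ≠ 0 := norm_pos_iff.1 (by
    linarith [zkap_norm hp (z := y * I) (by simp) n, (Nat.cast_nonneg n : (0:ℝ) ≤ n)])
  have h2 : Iz L ((starRingEnd ℂ) (kap p n)) (y * I) = (starRingEnd ℂ) (Iz L (kap p n) (-(y * I))) := by
    rw [← Iz_conj, map_neg, conj_yI, neg_neg]
  have h0' : kap p n - -(y * I) ≠ 0 := by rw [sub_neg_eq_add, add_comm]; exact h0
  have h3 := Iz_of_ne L h0'
  have h4 : Complex.exp (-(y * I) * L) / (2 * ((n:ℂ) + 1)) = (starRingEnd ℂ) (Complex.exp (y * I * L) / (2 * ((n:ℂ) + 1))) := by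
    rw [map_div₀, ← Complex.exp_conj, map_mul, conj_yI, Complex.conj_ofReal, map_mul, conj_two]
    simp
  have h5 : Complex.exp (y * I * L) * hterm n (1/2 + p + y * I) = Complex.exp (y * I * L) / (2 * ((n:ℂ) + 1))
      - Complex.exp (-kap p n * L) / (y * I + kap p n) - Iz L (kap p n) (-(y * I)) := by
    rw [h3, hterm]
    have e1 : 1/2 + p + y * I + 2 * ((n:ℂ) + 1) = y * I + kap p n := by rw [kap]; ring
    have e2 : kap p n - -(y * I) = y * I + kap p n := by ring
    rw [e1, e2, neg_neg]; ring
  rw [h5, qn, h2, h4]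
  simp only [sub_re, Complex.conj_re]

theorem VH_boundary {L : ℝ} (hL : 0 < L) {p : ℂ} (hp : 0 < p.re) (y : ℝ) :
    (VH L p (y * I)).re = (Complex.exp (y * I * L) * Hs (1/2 + p + y * I)).re := by
  have hs : Summable (fun n => hterm n (1/2 + p + y * I)) := hterm_summable (by simp; linarith)
  have hq := qn_summable hL hp (z := y * I) (by simp)
  rw [VH, Hs, mul_sub, ← tsum_mul_left, sub_re, sub_re, Complex.re_tsum hq, Complex.re_tsum (hs.mul_left _)]
  congr 1
  · exact tsum_congr (fun n => qn_boundary L hp y n)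
  · have : Complex.exp (-(y * I) * L) = (starRingEnd ℂ) (Complex.exp (y * I * L)) := by
      rw [← Complex.exp_conj, map_mul, conj_yI, Complex.conj_ofReal]
    rw [this, CH, mul_comm, Complex.re_mul_ofReal, Complex.re_mul_ofReal, Complex.conj_re]

end ZL

end PartG2

section PartG3
open Complex Filter Topology Set Metric

namespace ZL

noncomputable def FF (p z : ℂ) : ℂ := Zs (1/2 + p + z) + Hs (1/2 + p + z)

noncomputable def W (θ L : ℝ) (p z : ℂ) : ℂ :=
  θ * FF p z + 1/2 * (Complex.exp (-z * L) * FF p z) + 1/2 * (VZ L p z + VH L p z)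

theorem FF_diff (RH : RiemannHypothesis) {p z : ℂ} (hz : 0 < p.re + z.re) : DifferentiableAt ℂ (FF p) z := by
  have h : DifferentiableAt ℂ (fun s => Zs s + Hs s) (1/2 + p + z) :=
    (Zs_diff RH (by simp; linarith)).add (Hs_diff (by simp; linarith))
  exact DifferentiableAt.comp (g := fun s => Zs s + Hs s) (f := fun z : ℂ => 1/2 + p + z) z h (by fun_prop)

theorem FF_growth (RH : RiemannHypothesis) {p : ℂ} (hp : 0 < p.re) :
    ∃ C : ℝ, 0 ≤ C ∧ ∀ z : ℂ, 0 ≤ z.re → ‖FF p z‖ ≤ C * (1 + Real.sqrt ‖z‖) := by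
  obtain ⟨A, hA, hAb⟩ := Zs_growth RH hp
  obtain ⟨B, hB, hBb⟩ := Hs_growth
  set q := Real.sqrt ‖1/2 + p‖ with hq
  have hq0 : 0 ≤ q := Real.sqrt_nonneg _
  refine ⟨(A + B) * (1 + q), by positivity, fun z hz => ?_⟩
  have h1 := hAb (1/2 + p + z) (by simp; linarith)
  have h2 := hBb (1/2 + p + z) (by simp; linarith)
  have h3 := sqrt_shift (1/2 + p) z
  have hs := Real.sqrt_nonneg ‖z‖
  refine (norm_add_le _ _).trans ((add_le_add h1 h2).trans ?_)
  rw [← add_mul, mul_assoc]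
  apply mul_le_mul_of_nonneg_left _ (by linarith)
  nlinarith

theorem W_diff (RH : RiemannHypothesis) (θ : ℝ) {L : ℝ} (hL : 0 < L) {p : ℂ} (hp : 0 < p.re) :
    DiffContOnCl ℂ (W θ L p) {z | 0 < z.re} := by
  have key : ∀ f : ℂ → ℂ, (∀ z : ℂ, 0 ≤ z.re → DifferentiableAt ℂ f z) → DiffContOnCl ℂ f {z | 0 < z.re} := by
    intro f hf
    constructor
    · intro z hz
      exact (hf z (le_of_lt hz)).differentiableWithinAt
    · rw [closure_half]
      intro z hz
      exact (hf z hz).continuousAt.continuousWithinAt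
  have h1 : DiffContOnCl ℂ (fun z => θ * FF p z + 1/2 * (Complex.exp (-z * L) * FF p z) + 1/2 * VZ L p z) {z | 0 < z.re} := by
    apply key
    intro z hz
    have a := FF_diff RH (p := p) (z := z) (by linarith)
    have b := VZ_diff RH L (p := p) (z := z) (by linarith)
    have c : DifferentiableAt ℂ (fun z : ℂ => Complex.exp (-z * L)) z := (expL_deriv L z).differentiableAt
    exact ((a.const_mul _).add ((c.mul a).const_mul _)).add (b.const_mul _)
  have h2 := (VH_diff hL hp).const_smul (1/2 : ℂ)
  have h3 := h1.add h2
  have h4 : W θ L p = (fun z => θ * FF p z + 1/2 * (Complex.exp (-z * L) * FF p z) + 1/2 * VZ L p z) + (1/2 : ℂ) • VH L p := by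
    funext z
    simp only [W, Pi.add_apply, Pi.smul_apply, smul_eq_mul]; ring
  rw [h4]; exact h3

theorem W_growth (RH : RiemannHypothesis) (θ : ℝ) {L : ℝ} (hL : 0 < L) {p : ℂ} (hp : 0 < p.re) :
    ∃ C : ℝ, 0 ≤ C ∧ ∀ z : ℂ, 0 ≤ z.re → ‖W θ L p z‖ ≤ C * (1 + Real.sqrt ‖z‖) := by
  obtain ⟨A, hA, hAb⟩ := FF_growth RH hp
  obtain ⟨B, hB, hBb⟩ := VZ_growth RH hL hp
  obtain ⟨C, hC, hCb⟩ := VH_growth hL hp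
  refine ⟨|θ| * A + A + B + C, by positivity, fun z hz => ?_⟩
  have hez : ‖Complex.exp (-z * L)‖ ≤ 1 := by
    rw [norm_expL]; exact Real.exp_le_one_iff.2 (by nlinarith)
  set s := 1 + Real.sqrt ‖z‖ with hs
  have hs0 : 0 ≤ s := by positivity
  have h1 : ‖(θ:ℂ) * FF p z‖ ≤ |θ| * A * s := by
    rw [norm_mul, Complex.norm_real, Real.norm_eq_abs, mul_assoc]
    exact mul_le_mul_of_nonneg_left (hAb z hz) (abs_nonneg _)
  have h2 : ‖1/2 * (Complex.exp (-z * L) * FF p z)‖ ≤ A * s := by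
    rw [norm_mul, norm_mul]
    have := hAb z hz
    have e : ‖(1/2 : ℂ)‖ = 1/2 := by norm_num
    rw [e]
    nlinarith [norm_nonneg (FF p z), norm_nonneg (Complex.exp (-z * L))]
  have h3 : ‖1/2 * (VZ L p z + VH L p z)‖ ≤ B * s + C * s := by
    rw [norm_mul]
    have e : ‖(1/2 : ℂ)‖ = 1/2 := by norm_num
    rw [e]
    have := norm_add_le (VZ L p z) (VH L p z)
    nlinarith [norm_nonneg (VZ L p z + VH L p z), hBb z hz, hCb z hz]
  refine (norm_add_le _ _).trans ((add_le_add ((norm_add_le _ _).trans (add_le_add h1 h2)) h3).trans ?_)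
  linarith

theorem W_boundary (θ : ℝ) {L : ℝ} (hL : 0 < L) {p : ℂ} (hp : 0 < p.re) (y : ℝ) :
    (W θ L p (y * I)).re = (FF p (y * I)).re * (θ + Real.cos (y * L)) := by
  have e1 : (VZ L p (y * I) + VH L p (y * I)).re = (Complex.exp (y * I * L) * FF p (y * I)).re := by
    rw [add_re, VZ_boundary, VH_boundary hL hp, FF, mul_add, add_re]
  have e2 : (1/2 : ℂ) = ((1/2 : ℝ) : ℂ) := by push_cast; ring
  have c1 : y * I * L = ((y * L : ℝ) : ℂ) * I := by push_cast; ring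
  have c2 : -(y * I) * L = ((-(y * L) : ℝ) : ℂ) * I := by push_cast; ring
  rw [W, add_re, add_re, e2, Complex.re_ofReal_mul, Complex.re_ofReal_mul, Complex.re_ofReal_mul, e1,
    c1, c2, mul_re, mul_re, Complex.exp_ofReal_mul_I_re, Complex.exp_ofReal_mul_I_re, Complex.exp_ofReal_mul_I_im,
    Complex.exp_ofReal_mul_I_im, Real.cos_neg, Real.sin_neg]
  ring

theorem W_pos (RH : RiemannHypothesis) {L : ℝ} (hL : 0 < L) {p : ℂ} (hp : 0 < p.re) :
    0 ≤ (W 1 L p (1/2)).re := by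
  obtain ⟨C, hC, h⟩ := W_growth RH 1 hL hp
  refine re_nonneg_of_boundary (W_diff RH 1 hL hp) hC h ?_ (by norm_num)
  intro y
  rw [W_boundary 1 hL hp]
  apply mul_nonneg
  · exact re_F_nonneg RH (by simp; linarith)
  · linarith [Real.neg_one_le_cos (y * L)]

theorem W_neg (RH : RiemannHypothesis) {L : ℝ} (hL : 0 < L) {p : ℂ} (hp : 0 < p.re) :
    (W (-1) L p (1/2)).re ≤ 0 := by
  obtain ⟨C, hC, h⟩ := W_growth RH (-1) hL hp
  have := re_nonneg_of_boundary (f := fun z => -W (-1) L p z) (W_diff RH (-1) hL hp).neg hC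
    (fun z hz => by rw [norm_neg]; exact h z hz) ?_ (z := 1/2) (by norm_num)
  · rw [neg_re] at this; linarith
  · intro y
    rw [neg_re, W_boundary (-1) hL hp, ← mul_neg]
    apply mul_nonneg
    · exact re_F_nonneg RH (by simp; linarith)
    · linarith [Real.cos_le_one (y * L)]

/-- the tiny remainder -/
noncomputable def tau (L : ℝ) (p : ℂ) (n : ℕ) : ℂ :=
  Complex.exp (-kap p n * L) / ((p + 2 * ((n:ℂ) + 1)) * (p + 2 * ((n:ℂ) + 1) + 1))

noncomputable def vv (L : ℝ) : ℝ := Real.exp (-(L / 2))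

theorem vv_pos (L : ℝ) : 0 < vv L := Real.exp_pos _

theorem exp_half_neg (L : ℝ) : Complex.exp (-(1/2) * L) = (vv L : ℂ) := by
  rw [vv, Complex.ofReal_exp]; congr 1; push_cast; ring

theorem exp_half_pos (L : ℝ) : Complex.exp ((1/2) * L) = ((vv L)⁻¹ : ℝ) := by
  rw [vv, ← Real.exp_neg, Complex.ofReal_exp]; congr 1; push_cast; ring

theorem tau_bound {L : ℝ} (hL : 0 < L) {p : ℂ} (hp : 0 < p.re) (n : ℕ) :
    ‖tau L p n‖ ≤ vv L ^ 5 * (1 / 4) * (1 / ((n:ℝ) + 1) ^ 2) := by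
  set m : ℝ := (n:ℝ) + 1 with hm
  have hm1 : 1 ≤ m := by rw [hm]; linarith [(Nat.cast_nonneg n : (0:ℝ) ≤ n)]
  have hmC : ((n:ℂ) + 1) = (m:ℂ) := by rw [hm]; push_cast; ring
  rw [tau, norm_div, norm_mul, norm_expL, kap_re, hmC]
  have h1 : 2 * m ≤ ‖p + 2 * (m:ℂ)‖ := by
    have := (abs_le.1 (abs_re_le_norm (p + 2 * (m:ℂ)))).2
    simp at this; linarith
  have h2 : 2 * m ≤ ‖p + 2 * (m:ℂ) + 1‖ := by
    have := (abs_le.1 (abs_re_le_norm (p + 2 * (m:ℂ) + 1))).2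
    simp at this; linarith
  have h3 : Real.exp (-((p.re + 1/2 + 2 * m) * L)) ≤ vv L ^ 5 := by
    rw [vv, ← Real.exp_nat_mul]
    apply Real.exp_le_exp.2
    push_cast
    nlinarith
  calc _ ≤ vv L ^ 5 / (2 * m * (2 * m)) := by
        have := vv_pos L
        gcongr
    _ = _ := by field_simp; norm_num

theorem tau_hasSum_bound {L : ℝ} (hL : 0 < L) {p : ℂ} (hp : 0 < p.re) :
    Summable (tau L p) ∧ ‖∑' n, tau L p n‖ ≤ vv L ^ 5 := by
  have hz : HasSum (fun n : ℕ => 1 / ((n:ℝ) + 1) ^ 2) (Real.pi ^ 2 / 6) := by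
    have := (hasSum_nat_add_iff' 1).2 hasSum_zeta_two
    simpa using this
  have h := hz.mul_left (vv L ^ 5 * (1/4))
  refine ⟨Summable.of_norm_bounded h.summable (tau_bound hL hp), ?_⟩
  refine (tsum_of_norm_bounded h (tau_bound hL hp)).trans ?_
  have h5 : 0 < vv L ^ 5 := pow_pos (vv_pos L) 5
  have : Real.pi ^ 2 / 6 ≤ 4 := by nlinarith [Real.pi_pos, Real.pi_le_four]
  nlinarith

theorem qn_half (L : ℝ) {p : ℂ} (hp : 0 < p.re) (n : ℕ) :
    (qn L p n (1/2)).re = (vv L * hterm n p + tau L p n).re := by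
  have hn : (0:ℝ) ≤ n := Nat.cast_nonneg n
  have h1 : p + 2 * ((n:ℂ) + 1) ≠ 0 := by
    intro h; have := congrArg Complex.re h; simp at this; linarith
  have h2 : p + 2 * ((n:ℂ) + 1) + 1 ≠ 0 := by
    intro h; have := congrArg Complex.re h; simp at this; linarith
  have hk : kap p n - 1/2 = p + 2 * ((n:ℂ) + 1) := by rw [kap]; ring
  have hk2 : 1/2 + kap p n = p + 2 * ((n:ℂ) + 1) + 1 := by rw [kap]; ring
  have e : Iz L ((starRingEnd ℂ) (kap p n)) (1/2) = (starRingEnd ℂ) (Iz L (kap p n) (1/2)) := by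
    rw [← Iz_conj]; congr 1; simp [conj_two]
  have e3 : Iz L (kap p n) (1/2) = (vv L - Complex.exp (-kap p n * L)) / (p + 2 * ((n:ℂ) + 1)) := by
    rw [Iz_of_ne L (by rw [hk]; exact h1), exp_half_neg, hk]
  have e4 : (qn L p n (1/2)).re = ((vv L) / (2 * ((n:ℂ) + 1)) - Complex.exp (-kap p n * L) / (p + 2 * ((n:ℂ) + 1) + 1) - Iz L (kap p n) (1/2)).re := by
    rw [qn, e, exp_half_neg, hk2]; simp only [sub_re, Complex.conj_re]
  rw [e4, e3, hterm, tau]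
  congr 1
  have h3 : ((n:ℂ) + 1) ≠ 0 := by exact_mod_cast Nat.succ_ne_zero n
  field_simp
  ring

theorem VH_half {L : ℝ} (hL : 0 < L) {p : ℂ} (hp : 0 < p.re) :
    (VH L p (1/2)).re = vv L * (Hs p).re + (∑' n, tau L p n).re := by
  have hs : Summable (fun n => hterm n p) := hterm_summable (by linarith)
  have hq := qn_summable hL hp (z := 1/2) (by norm_num)
  have ht := (tau_hasSum_bound hL hp).1
  have e : ∑' n, (qn L p n (1/2)).re = (∑' n, (vv L * hterm n p + tau L p n)).re := by
    rw [Complex.re_tsum ((hs.mul_left _).add ht)]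
    exact tsum_congr (fun n => qn_half L hp n)
  rw [VH, sub_re, Complex.re_tsum hq, e, (hs.mul_left _).tsum_add ht, tsum_mul_left, exp_half_neg, add_re, Hs, CH,
    ← Complex.ofReal_mul, Complex.ofReal_re, Complex.re_ofReal_mul, sub_re, Complex.ofReal_re]
  ring

/-- the von Mangoldt sum part -/
noncomputable def SR (L : ℝ) (p : ℂ) : ℝ :=
  ∑ n ∈ Sx L, (an p n).re * (Real.exp (ell L n / 2) - Real.exp (-(ell L n / 2)))

noncomputable def PR (L : ℝ) (p : ℂ) : ℝ :=
  (Iz L (-(1/2)) (p - 1/2)).re - (Iz L (1/2) (p - 1/2)).re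

theorem Iz_symm (L : ℝ) (κ z : ℂ) : Iz L κ z = Iz L z κ := by
  rcases eq_or_ne (κ - z) 0 with h | h
  · rw [sub_eq_zero.1 h]
  · have h2 : z - κ ≠ 0 := by rw [← neg_sub]; exact neg_ne_zero.2 h
    rw [Iz_of_ne L h, Iz_of_ne L h2, div_eq_div_iff h h2]; ring

theorem VZ_half (L : ℝ) (p : ℂ) :
    (VZ L p (1/2)).re = (vv L)⁻¹ * (Zs (1 + p)).re + SR L p - PR L p := by
  have e1 : (1/2 + p + 1/2 : ℂ) = 1 + p := by ring
  have e2 : Iz L ((starRingEnd ℂ) (p - 1/2)) (1/2) = (starRingEnd ℂ) (Iz L (1/2) (p - 1/2)) := by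
    rw [Iz_symm, ← Iz_conj]; congr 1; simp [conj_two]
  rw [VZ, exp_half_pos, e1, e2, Iz_symm L (p - 1/2), sub_re, add_re, sub_re, Complex.conj_re, Complex.re_ofReal_mul, PR, SR, re_sum]
  congr 2
  apply Finset.sum_congr rfl
  intro n _
  have a1 : Complex.exp (1/2 * ell L n) = (Real.exp (ell L n / 2) : ℂ) := by
    rw [Complex.ofReal_exp]; congr 1; push_cast; ring
  have a2 : Complex.exp (-(1/2 * ell L n)) = (Real.exp (-(ell L n / 2)) : ℂ) := by
    rw [Complex.ofReal_exp]; congr 1; push_cast; ring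
  rw [a1, a2, sub_re, Complex.re_mul_ofReal, Complex.re_mul_ofReal, Complex.conj_re]; ring

theorem W_half (θ : ℝ) {L : ℝ} (hL : 0 < L) {p : ℂ} (hp : 0 < p.re) :
    2 * (W θ L p (1/2)).re = (2 * θ + vv L + (vv L)⁻¹) * (Zs (1 + p)).re + (2 * θ + vv L) * (Hs (1 + p)).re
      + SR L p - PR L p + vv L * (Hs p).re + (∑' n, tau L p n).re := by
  have e1 : (1/2 + p + 1/2 : ℂ) = 1 + p := by ring
  have e2 : (1/2 : ℂ) * (vv L * (Zs (1+p) + Hs (1+p))) = ((vv L / 2 : ℝ) : ℂ) * (Zs (1+p) + Hs (1+p)) := by push_cast; ring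
  have e3 : ∀ w : ℂ, (1/2 : ℂ) * w = ((1 / 2 : ℝ) : ℂ) * w := by intro w; push_cast; ring
  rw [W, FF, e1, exp_half_neg, e2, e3, add_re, add_re, Complex.re_ofReal_mul, Complex.re_ofReal_mul, Complex.re_ofReal_mul,
    add_re, add_re, VZ_half, VH_half hL hp]
  ring

end ZL

end PartG3

section PartH
open Complex Filter Topology Set Metric

namespace ZL

noncomputable def S0 (L : ℝ) : ℝ := ∑ n ∈ Sx L, vm n / n * (1 - n * vv L ^ 2)

theorem exp_ell (L : ℝ) {n : ℕ} (hn : 0 < n) :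
    Real.exp (ell L n / 2) = (vv L)⁻¹ / Real.sqrt n ∧ Real.exp (-(ell L n / 2)) = vv L * Real.sqrt n := by
  have hn' : (0:ℝ) < n := by exact_mod_cast hn
  have h : Real.sqrt n = Real.exp (Real.log n / 2) := by
    rw [Real.exp_half, Real.exp_log hn']
  constructor
  · rw [h, vv, ← Real.exp_neg, ← Real.exp_sub, ell]; congr 1; ring
  · rw [h, vv, ← Real.exp_add, ell]; congr 1; ring

theorem S0_term (L : ℝ) (n : ℕ) :
    vv L * (vm n / Real.sqrt n * (Real.exp (ell L n / 2) - Real.exp (-(ell L n / 2)))) = vm n / n * (1 - n * vv L ^ 2) := by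
  rcases Nat.eq_zero_or_pos n with rfl | hn
  · simp [vm_zero]
  obtain ⟨h1, h2⟩ := exp_ell L hn
  have hn' : (0:ℝ) < n := by exact_mod_cast hn
  have hv := vv_pos L
  have hr : 0 < Real.sqrt n := Real.sqrt_pos.2 hn'
  have e : (n:ℝ) = Real.sqrt n ^ 2 := (Real.sq_sqrt hn'.le).symm
  rw [h1, h2]
  set r := Real.sqrt n
  rw [e]
  field_simp

theorem SR_le {L : ℝ} {p : ℂ} (hp : 0 ≤ p.re) : vv L * SR L p ≤ S0 L := by
  rw [SR, S0, Finset.mul_sum]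
  apply Finset.sum_le_sum
  intro n hn
  rw [← S0_term]
  apply mul_le_mul_of_nonneg_left _ (vv_pos L).le
  rcases Nat.eq_zero_or_pos n with rfl | hn0
  · simp [an, vm_zero]
  have hn1 : (1:ℝ) ≤ n := by exact_mod_cast hn0
  have hl : 0 ≤ ell L n := by
    rw [mem_Sx] at hn
    have := Real.log_le_log (by exact_mod_cast hn0) hn
    rw [Real.log_exp] at this
    unfold ell; linarith
  apply mul_le_mul_of_nonneg_right
  · refine (Complex.re_le_norm _).trans ?_
    rw [an, vm_norm, div_eq_mul_inv (vm n), Real.sqrt_eq_rpow, ← Real.rpow_neg (by linarith)]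
    apply mul_le_mul_of_nonneg_left _ (vm_nonneg n)
    apply Real.rpow_le_rpow_of_exponent_le hn1
    simp; linarith
  · have : Real.exp (-(ell L n / 2)) ≤ Real.exp (ell L n / 2) := Real.exp_le_exp.2 (by linarith)
    linarith

theorem SR_zero (L : ℝ) : vv L * SR L 0 = S0 L := by
  rw [SR, S0, Finset.mul_sum]
  apply Finset.sum_congr rfl
  intro n _
  rw [← S0_term]
  congr 2
  rcases Nat.eq_zero_or_pos n with rfl | hn0
  · simp [an, vm_zero]
  have e : (-(1/2 + 0) : ℂ) = ((-(1/2) : ℝ) : ℂ) := by push_cast; ring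
  have e2 : (n:ℂ) = ((n:ℝ):ℂ) := by push_cast; rfl
  rw [an, e, e2, ← Complex.ofReal_cpow (Nat.cast_nonneg n), ← Complex.ofReal_mul, Complex.ofReal_re, Real.rpow_neg (Nat.cast_nonneg n), ← Real.sqrt_eq_rpow, div_eq_mul_inv]

theorem PR_bound {L : ℝ} (hL : 0 < L) {δ t : ℝ} (hδ : 0 < δ) (ht : 0 < t) :
    -(vv L * PR L (δ + t * I)) ≤ 4 / t := by
  set p : ℂ := δ + t * I with hp
  have hv := vv_pos L
  have hv1 : vv L ≤ 1 := by rw [vv]; exact Real.exp_le_one_iff.2 (by linarith)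
  have hpre : p.re = δ := by simp [hp]
  have hpim : p.im = t := by simp [hp]
  have hpn : t ≤ ‖p‖ := by
    have := (abs_le.1 (abs_im_le_norm p)).2
    linarith
  have hpn2 : t ≤ ‖1 - p‖ := by
    have := (abs_le.1 (abs_im_le_norm (1 - p))).1
    rw [sub_im, hpim] at this; simp at this; linarith
  have hiv : 1 ≤ (vv L)⁻¹ := (one_le_inv₀ hv).2 hv1
  have hE : ‖Complex.exp (-(p - 1/2) * L)‖ ≤ (vv L)⁻¹ := by
    rw [norm_expL, vv, ← Real.exp_neg]
    apply Real.exp_le_exp.2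
    rw [sub_re, hpre]; norm_num; nlinarith
  have hE2 : ‖Complex.exp (-(1/2) * L)‖ ≤ (vv L)⁻¹ := by
    rw [exp_half_neg, Complex.norm_real, Real.norm_eq_abs, abs_of_pos hv]; linarith
  have hE3 : ‖Complex.exp (- -(1/2) * L)‖ ≤ (vv L)⁻¹ := by
    rw [neg_neg, exp_half_pos, Complex.norm_real, Real.norm_eq_abs, abs_of_pos (inv_pos.2 hv)]
  have a1 : -(1/2) - (p - 1/2) = -p := by ring
  have a2 : (1/2) - (p - 1/2) = 1 - p := by ring
  have hn1 : -(1/2) - (p - 1/2) ≠ 0 := by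
    rw [a1]; exact neg_ne_zero.2 (norm_pos_iff.1 (by linarith))
  have hn2 : (1/2) - (p - 1/2) ≠ 0 := by
    rw [a2]; exact norm_pos_iff.1 (by linarith)
  have b1 : ‖Iz L (-(1/2)) (p - 1/2)‖ ≤ 2 * (vv L)⁻¹ / t := by
    rw [Iz_of_ne L hn1, a1, norm_div, norm_neg]
    have := norm_sub_le (Complex.exp (-(p - 1/2) * L)) (Complex.exp (- -(1/2) * L))
    gcongr; linarith
  have b2 : ‖Iz L (1/2) (p - 1/2)‖ ≤ 2 * (vv L)⁻¹ / t := by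
    rw [Iz_of_ne L hn2, a2, norm_div]
    have := norm_sub_le (Complex.exp (-(p - 1/2) * L)) (Complex.exp (-(1/2) * L))
    gcongr; linarith
  have c1 := (abs_le.1 (abs_re_le_norm (Iz L (-(1/2)) (p - 1/2)))).1
  have c2 := (abs_le.1 (abs_re_le_norm (Iz L (1/2) (p - 1/2)))).2
  have : -PR L p ≤ 4 * (vv L)⁻¹ / t := by
    have : 4 * (vv L)⁻¹ / t = 2 * (vv L)⁻¹ / t + 2 * (vv L)⁻¹ / t := by ring
    rw [PR, this]; linarith
  calc -(vv L * PR L p) = vv L * (-PR L p) := by ring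
    _ ≤ vv L * (4 * (vv L)⁻¹ / t) := by gcongr
    _ = 4 / t := by field_simp

theorem line_tendsto (f : ℂ → ℂ) (c : ℂ) (h : ContinuousAt f c) :
    Tendsto (fun δ : ℝ => (f (c + δ)).re) (𝓝[>] 0) (𝓝 (f c).re) := by
  have h1 : Tendsto (fun δ : ℝ => c + (δ:ℂ)) (𝓝[>] 0) (𝓝 c) := by
    have : Continuous (fun δ : ℝ => c + (δ:ℂ)) := by fun_prop
    have := this.tendsto 0
    simp at this
    exact this.mono_left nhdsWithin_le_nhds
  exact (Complex.continuous_re.tendsto _).comp (h.tendsto.comp h1)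

theorem caseB (RH : RiemannHypothesis) {L t : ℝ} (hL : 0 < L) (ht : 0 < t) :
    0 ≤ (1 + vv L) ^ 2 * (Zs (1 + t * I)).re + (2 * vv L + vv L ^ 2) * (Hs (1 + t * I)).re
      + vv L ^ 2 * (Hs (t * I)).re + S0 L + vv L ^ 6 + 4 / t := by
  have hv := vv_pos L
  have key : ∀ δ : ℝ, 0 < δ → 0 ≤ (1 + vv L) ^ 2 * (Zs (1 + t * I + δ)).re + (2 * vv L + vv L ^ 2) * (Hs (1 + t * I + δ)).re
      + vv L ^ 2 * (Hs (t * I + δ)).re + S0 L + vv L ^ 6 + 4 / t := by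
    intro δ hδ
    have hp : 0 < ((δ:ℂ) + t * I).re := by simpa using hδ
    have h1 := W_pos RH hL hp
    have h2 := W_half 1 hL hp
    have h3 := SR_le (L := L) hp.le
    have h4 := PR_bound hL hδ ht
    have h5 := (tau_hasSum_bound hL hp).2
    have h6 := (Complex.re_le_norm (∑' n, tau L (δ + t * I) n)).trans h5
    have e1 : (1 + t * I + δ : ℂ) = 1 + (δ + t * I) := by ring
    have e2 : (t * I + δ : ℂ) = δ + t * I := by ring
    rw [e1, e2]
    set Z := (Zs (1 + (δ + t * I))).re
    set X := (Hs (1 + (δ + t * I))).re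
    set Y := (Hs (δ + t * I)).re
    set T := (∑' n, tau L (δ + t * I) n).re
    set R := SR L (δ + t * I)
    set P := PR L (δ + t * I)
    have h7 : 0 ≤ vv L * ((2 * 1 + vv L + (vv L)⁻¹) * Z + (2 * 1 + vv L) * X + R - P + vv L * Y + T) := by
      rw [← h2]; positivity
    have h8 : vv L * ((2 * 1 + vv L + (vv L)⁻¹) * Z + (2 * 1 + vv L) * X + R - P + vv L * Y + T)
      = (1 + vv L) ^ 2 * Z + (2 * vv L + vv L ^ 2) * X + vv L ^ 2 * Y + vv L * R - vv L * P + vv L * T := by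
      field_simp; ring
    have h9 : vv L * T ≤ vv L ^ 6 := by
      calc vv L * T ≤ vv L * vv L ^ 5 := by gcongr
        _ = _ := by ring
    linarith
  have l1 := line_tendsto Zs (1 + t * I) (Zs_diff RH (by simp; norm_num)).continuousAt
  have l2 := line_tendsto Hs (1 + t * I) (Hs_diff (by simp)).continuousAt
  have l3 := line_tendsto Hs (t * I) (Hs_diff (by simp)).continuousAt
  have l := (((((l1.const_mul ((1 + vv L)^2)).add (l2.const_mul (2 * vv L + vv L ^ 2))).add (l3.const_mul (vv L ^ 2))).add_const (S0 L)).add_const (vv L ^ 6)).add_const (4 / t)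
  refine ge_of_tendsto l ?_
  filter_upwards [self_mem_nhdsWithin] with δ hδ
  exact key δ hδ

theorem tau_real {L δ : ℝ} (hL : 0 < L) (hδ : 0 < δ) : 0 ≤ (∑' n, tau L δ n).re := by
  rw [Complex.re_tsum (tau_hasSum_bound hL (p := δ) (by simpa using hδ)).1]
  apply tsum_nonneg
  intro n
  have : tau L δ n = ((Real.exp (-(δ + 1/2 + 2 * ((n:ℝ) + 1)) * L) / ((δ + 2 * ((n:ℝ) + 1)) * (δ + 2 * ((n:ℝ) + 1) + 1)) : ℝ) : ℂ) := by
    rw [tau, kap]; push_cast; rfl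
  rw [this, Complex.ofReal_re]
  positivity

theorem Zs_one : (Zs 1).re = Real.eulerMascheroniConstant := by
  rw [Zs, logDeriv_apply, deriv_riemannZeta₁_one, riemannZeta₁_one]; simp

theorem Hs_zero : (Hs 0).re = -(Real.eulerMascheroniConstant / 2 + Real.log Real.pi / 2) := by
  rw [Hs]
  have : ∀ n, hterm n 0 = 0 := by intro n; simp [hterm]
  simp [this]

theorem Hs_one : (Hs 1).re = 1 - Real.eulerMascheroniConstant / 2 - Real.log 2 - Real.log Real.pi / 2 := by
  rw [Hs_eq (by norm_num), digamma_apply_add_one, digamma_one_half]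
  · have : (Complex.log 2) = ((Real.log 2 : ℝ) : ℂ) := by rw [Complex.ofReal_log (by norm_num)]; norm_num
    rw [this]
    have : ((-2 * ((Real.log 2 : ℝ) : ℂ) - Real.eulerMascheroniConstant + (1/2)⁻¹) / 2 - ((Real.log Real.pi / 2 : ℝ) : ℂ))
      = ((1 - Real.eulerMascheroniConstant / 2 - Real.log 2 - Real.log Real.pi / 2 : ℝ) : ℂ) := by push_cast; ring
    rw [this, Complex.ofReal_re]
  · intro m h
    have := congrArg Complex.re h
    simp at this
    have h2 : (0:ℝ) ≤ m := Nat.cast_nonneg m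
    norm_num at this
    linarith

theorem PR_zero (L : ℝ) : vv L * PR L 0 = L - 1 + vv L ^ 2 := by
  have hv := vv_pos L
  have e1 : (0 - 1/2 : ℂ) = -(1/2) := by ring
  have h : (1/2 : ℂ) - -(1/2) ≠ 0 := by norm_num
  have e2 : (1/2 : ℂ) - -(1/2) = 1 := by norm_num
  rw [PR, e1, Iz_self, Iz_of_ne L h, neg_neg, exp_half_pos, exp_half_neg, e2, div_one, sub_re, Complex.re_ofReal_mul, Complex.ofReal_re, Complex.ofReal_re]
  field_simp
  ring

theorem SR_tendsto (L : ℝ) : Tendsto (fun δ : ℝ => SR L δ) (𝓝[>] 0) (𝓝 (SR L 0)) := by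
  unfold SR
  apply tendsto_finsetSum
  intro n _
  apply Tendsto.mul_const
  have := line_tendsto (fun p => an p n) 0 ?_
  · simpa using this
  · rcases Nat.eq_zero_or_pos n with rfl | hn0
    · simp [an, vm_zero]; exact continuousAt_const
    · unfold an
      have hn : (n:ℂ) ≠ 0 := by exact_mod_cast hn0.ne'
      apply ContinuousAt.mul continuousAt_const
      apply ContinuousAt.const_cpow _ (Or.inl hn)
      fun_prop

theorem PR_tendsto (L : ℝ) : Tendsto (fun δ : ℝ => PR L δ) (𝓝[>] 0) (𝓝 (PR L 0)) := by
  unfold PR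
  have c1 : ∀ κ : ℂ, Continuous (fun p : ℂ => Iz L κ (p - 1/2)) := fun κ => (Iz_diff L κ).continuous.comp (by fun_prop)
  have h1 := line_tendsto _ 0 (c1 (-(1/2))).continuousAt
  have h2 := line_tendsto _ 0 (c1 (1/2)).continuousAt
  simpa using h1.sub h2

theorem caseA (RH : RiemannHypothesis) {L : ℝ} (hL : 0 < L) :
    S0 L ≤ L - 1 - Real.eulerMascheroniConstant + vv L ^ 2 * (Real.log 2 + Real.log Real.pi)
      + 2 * vv L * (1 + Real.eulerMascheroniConstant / 2 - Real.log 2 - Real.log Real.pi / 2) := by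
  have hv := vv_pos L
  have key : ∀ δ : ℝ, 0 < δ → (1 - vv L) ^ 2 * (Zs (1 + δ)).re + (vv L ^ 2 - 2 * vv L) * (Hs (1 + δ)).re
      + vv L ^ 2 * (Hs (0 + δ)).re + vv L * SR L δ - vv L * PR L δ ≤ 0 := by
    intro δ hδ
    have hp : 0 < (δ:ℂ).re := by simpa using hδ
    have h1 := W_neg RH hL hp
    have h2 := W_half (-1) hL hp
    have h6 := tau_real hL hδ
    rw [zero_add]
    set Z := (Zs (1 + δ)).re
    set X := (Hs (1 + δ)).re
    set Y := (Hs δ).re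
    set T := (∑' n, tau L δ n).re
    set R := SR L δ
    set P := PR L δ
    have h7 : vv L * ((2 * (-1) + vv L + (vv L)⁻¹) * Z + (2 * (-1) + vv L) * X + R - P + vv L * Y + T) ≤ 0 := by
      rw [← h2]; nlinarith
    have h8 : vv L * ((2 * (-1) + vv L + (vv L)⁻¹) * Z + (2 * (-1) + vv L) * X + R - P + vv L * Y + T)
      = (1 - vv L) ^ 2 * Z + (vv L ^ 2 - 2 * vv L) * X + vv L ^ 2 * Y + vv L * R - vv L * P + vv L * T := by
      field_simp; ring
    have h9 : 0 ≤ vv L * T := by positivity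
    linarith
  have l1 := line_tendsto Zs 1 (Zs_diff RH (by simp; norm_num)).continuousAt
  have l2 := line_tendsto Hs 1 (Hs_diff (by simp)).continuousAt
  have l3 := line_tendsto Hs 0 (Hs_diff (by simp)).continuousAt
  have l := ((((l1.const_mul ((1 - vv L)^2)).add (l2.const_mul (vv L ^ 2 - 2 * vv L))).add (l3.const_mul (vv L ^ 2))).add ((SR_tendsto L).const_mul (vv L))).sub ((PR_tendsto L).const_mul (vv L))
  have h := le_of_tendsto l (b := 0) (by
    filter_upwards [self_mem_nhdsWithin] with δ hδ
    exact key δ hδ)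
  rw [SR_zero, PR_zero, Zs_one, Hs_zero, Hs_one] at h
  nlinarith [h]

end ZL

end PartH

section PartIJ
open Complex Filter Topology Set Metric

namespace ZL

theorem hterm_re (n : ℕ) (a τ : ℝ) (ha : 0 ≤ a) :
    (hterm n ((2 * a : ℝ) + (2 * τ : ℝ) * I)).re = (1 / ((n:ℝ) + 1) - (a + n + 1) / ((a + n + 1) ^ 2 + τ ^ 2)) / 2 := by
  have hn : (0:ℝ) ≤ n := Nat.cast_nonneg n
  have e1 : ((2 * a : ℝ) : ℂ) + (2 * τ : ℝ) * I + 2 * ((n:ℂ) + 1) = ((2 * (a + n + 1) : ℝ) : ℂ) + (2 * τ : ℝ) * I := by push_cast; ring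
  have e2 : (1 : ℂ) / (2 * ((n:ℂ) + 1)) = ((1 / (2 * ((n:ℝ) + 1)) : ℝ) : ℂ) := by push_cast; ring
  rw [hterm, e1, e2, sub_re, Complex.ofReal_re, one_div, one_div, Complex.inv_re, Complex.normSq_apply]
  simp only [add_re, mul_re, add_im, mul_im, ofReal_re, ofReal_im, I_re, I_im]
  have : 0 < (a + n + 1) ^ 2 + τ ^ 2 := by positivity
  have h2 : 2 * (a + n + 1) + (2 * τ * 0 - 0 * 1) = 2 * (a + n + 1) := by ring
  have h3 : 0 + (2 * τ * 1 + 0 * 0) = 2 * τ := by ring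
  rw [h2, h3]
  have h4 : 2 * (a + n + 1) * (2 * (a + n + 1)) + 2 * τ * (2 * τ) = 4 * ((a + n + 1) ^ 2 + τ ^ 2) := by ring
  rw [h4]
  field_simp
  ring

theorem step_ineq {u τ : ℝ} (hu : 0 < u) :
    -(u / (u ^ 2 + τ ^ 2)) ≤ -(1/2 * Real.log ((u + 1) ^ 2 + τ ^ 2)) + 1/2 * Real.log (u ^ 2 + τ ^ 2) + 1/2 * (1 / (u ^ 2 + τ ^ 2)) := by
  have h0 : 0 < u ^ 2 + τ ^ 2 := by positivity
  have h1 : 0 < (u + 1) ^ 2 + τ ^ 2 := by positivity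
  have := Real.log_le_sub_one_of_pos (div_pos h1 h0)
  rw [Real.log_div h1.ne' h0.ne'] at this
  have e : ((u + 1) ^ 2 + τ ^ 2) / (u ^ 2 + τ ^ 2) - 1 = 2 * (u / (u ^ 2 + τ ^ 2)) + 1 / (u ^ 2 + τ ^ 2) := by
    field_simp; ring
  rw [e] at this
  linarith

theorem tele_ineq {a τ : ℝ} (ha : 0 ≤ a) (hτ : 0 < τ) (n : ℕ) :
    1/2 * (1 / ((a + n + 1) ^ 2 + τ ^ 2)) ≤ 1 / (n + τ) - 1 / (n + 1 + τ) := by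
  have hn : (0:ℝ) ≤ n := Nat.cast_nonneg n
  have e : 1 / (n + τ) - 1 / (n + 1 + τ) = 1 / ((n + τ) * (n + 1 + τ)) := by field_simp; ring
  have e' : 1/2 * (1 / ((a + n + 1) ^ 2 + τ ^ 2)) = 1 / (2 * ((a + n + 1) ^ 2 + τ ^ 2)) := by field_simp
  rw [e, e']
  apply one_div_le_one_div_of_le (by positivity)
  nlinarith [sq_nonneg ((n:ℝ) + 1 - τ), mul_nonneg ha hn]

theorem partial_bound {a τ : ℝ} (ha : 0 ≤ a) (hτ : 0 < τ) (N : ℕ) :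
    ∑ n ∈ Finset.range N, (1 / ((n:ℝ) + 1) - (a + n + 1) / ((a + n + 1) ^ 2 + τ ^ 2)) ≤
      (harmonic N : ℝ) - 1/2 * Real.log ((a + N + 1) ^ 2 + τ ^ 2) + 1/2 * Real.log ((a + 1) ^ 2 + τ ^ 2) + (1 / τ - 1 / (N + τ)) := by
  induction N with
  | zero => simp
  | succ N ih =>
    rw [Finset.sum_range_succ, harmonic_succ]
    have h1 := step_ineq (u := a + N + 1) (τ := τ) (by positivity)
    have h2 := tele_ineq ha hτ N
    have e : a + (N:ℝ) + 1 + 1 = a + ((N + 1 : ℕ) : ℝ) + 1 := by push_cast; ring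
    have e2 : (N:ℝ) + 1 + τ = ((N + 1 : ℕ) : ℝ) + τ := by push_cast; ring
    rw [e] at h1
    rw [e2] at h2
    have e3 : (((harmonic N + ((N + 1 : ℕ) : ℚ)⁻¹ : ℚ)) : ℝ) = (harmonic N : ℝ) + 1 / ((N:ℝ) + 1) := by push_cast; rw [one_div]
    rw [e3]
    linarith

theorem Hs_upper0 {a τ : ℝ} (ha : 0 ≤ a) (ha1 : a ≤ 1/2) (hτ : 3 ≤ τ) :
    (Hs ((2 * a : ℝ) + (2 * τ : ℝ) * I)).re ≤ (Real.log τ - Real.log Real.pi) / 2 + 1 / τ := by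
  have hs := hterm_summable (s := (2 * a : ℝ) + (2 * τ : ℝ) * I) (by simp; linarith)
  have hτ0 : 0 < τ := by linarith
  have hS : (∑' n, hterm n ((2 * a : ℝ) + (2 * τ : ℝ) * I)).re ≤ (Real.eulerMascheroniConstant + Real.log τ + 2 / τ) / 2 := by
    have h1 := ((Complex.continuous_re.tendsto _).comp hs.hasSum.tendsto_sum_nat)
    refine le_of_tendsto h1 (Eventually.of_forall (fun N => ?_))
    simp only [Function.comp]
    rw [re_sum, Finset.sum_congr rfl (fun n _ => hterm_re n a τ ha), ← Finset.sum_div]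
    apply div_le_div_of_nonneg_right _ (by norm_num)
    refine (partial_bound ha hτ0 N).trans ?_
    have hN : (0:ℝ) ≤ N := Nat.cast_nonneg N
    have g := Real.eulerMascheroniSeq_lt_eulerMascheroniConstant N
    rw [Real.eulerMascheroniSeq] at g
    have l1 : Real.log ((N:ℝ) + 1) ≤ 1/2 * Real.log ((a + N + 1) ^ 2 + τ ^ 2) := by
      have : Real.log (((N:ℝ) + 1) ^ 2) ≤ Real.log ((a + N + 1) ^ 2 + τ ^ 2) := by
        apply Real.log_le_log (by positivity)
        nlinarith
      rw [Real.log_pow] at this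
      push_cast at this
      linarith
    have l2 : 1/2 * Real.log ((a + 1) ^ 2 + τ ^ 2) ≤ Real.log τ + 1 / τ := by
      have h0 : 0 < (a + 1) ^ 2 + τ ^ 2 := by positivity
      have := Real.log_le_sub_one_of_pos (div_pos h0 (by positivity : 0 < τ ^ 2))
      rw [Real.log_div h0.ne' (by positivity), Real.log_pow] at this
      have e : ((a + 1) ^ 2 + τ ^ 2) / τ ^ 2 - 1 = (a + 1) ^ 2 / τ ^ 2 := by field_simp; ring
      rw [e] at this
      have h3 : (a + 1) ^ 2 / τ ^ 2 ≤ 2 * (1 / τ) := by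
        rw [mul_one_div, div_le_div_iff₀ (by positivity) hτ0]
        have : (a + 1) ^ 2 ≤ 9/4 := by nlinarith
        nlinarith
      push_cast at this
      linarith
    have l3 : 0 ≤ 1 / (N + τ) := by positivity
    have e2 : 2 / τ = 1 / τ + 1 / τ := by ring
    rw [e2]
    linarith
  rw [Hs, sub_re, Complex.ofReal_re]
  have e2 : 2 / τ / 2 = 1 / τ := by ring
  linarith

theorem Hs_upper {σ t : ℝ} (h0 : 0 ≤ σ) (h1 : σ ≤ 1) (ht : 6 ≤ t) :
    (Hs (σ + t * I)).re ≤ (Real.log t - Real.log 2 - Real.log Real.pi) / 2 + 2 / t := by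
  have := Hs_upper0 (a := σ / 2) (τ := t / 2) (by linarith) (by linarith) (by linarith)
  have e1 : 2 * (σ / 2) = σ := by ring
  have e2 : 2 * (t / 2) = t := by ring
  have e3 : 1 / (t / 2) = 2 / t := by field_simp
  rw [e1, e2, e3, Real.log_div (by linarith) (by norm_num)] at this
  exact this

/-- explicit bound before the final numerics -/
theorem Y_bound (RH : RiemannHypothesis) {L t : ℝ} (hL : 0 < L) (ht : 6 ≤ t) :
    (1 + vv L) ^ 2 * (-(deriv riemannZeta (1 + t * I) / riemannZeta (1 + t * I)).re) ≤
      L - 1 - Real.eulerMascheroniConstant + vv L ^ 2 * (Real.log 2 + Real.log Real.pi)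
      + 2 * vv L * (1 + Real.eulerMascheroniConstant / 2 - Real.log 2 - Real.log Real.pi / 2)
      + 2 * vv L * (1 + vv L) * ((Real.log t - Real.log 2 - Real.log Real.pi) / 2 + 2 / t) + vv L ^ 6 + 4 / t := by
  have hv := vv_pos L
  have hB := caseB RH hL (by linarith : 0 < t)
  have hA := caseA RH hL
  have h1 := Hs_upper (σ := 1) (t := t) (by norm_num) le_rfl ht
  have h0 := Hs_upper (σ := 0) (t := t) le_rfl (by norm_num) ht
  rw [Complex.ofReal_one] at h1
  rw [Complex.ofReal_zero, zero_add] at h0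
  have hne : (1 + t * I : ℂ) ≠ 1 := by
    intro h
    have := congrArg Complex.im h
    simp at this; linarith
  have hz : riemannZeta (1 + t * I) ≠ 0 := riemannZeta_ne_zero_of_one_le_re (by simp)
  have hZ := congrArg Complex.re (Zs_eq hne hz)
  have e : ((1:ℂ) / (1 + t * I - 1)).re = 0 := by
    rw [add_sub_cancel_left]; simp
  rw [add_re, e, add_zero] at hZ
  rw [hZ] at hB
  set Y := (deriv riemannZeta (1 + t * I) / riemannZeta (1 + t * I)).re
  set h := (Real.log t - Real.log 2 - Real.log Real.pi) / 2 + 2 / t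
  have m1 := mul_le_mul_of_nonneg_left h1 (by positivity : 0 ≤ 2 * vv L + vv L ^ 2)
  have m0 := mul_le_mul_of_nonneg_left h0 (by positivity : 0 ≤ vv L ^ 2)
  nlinarith

theorem log_pi_lower : (1.134 : ℝ) ≤ Real.log Real.pi := by
  have h1 := Real.pi_gt_d4
  have h2 := Real.exp_one_lt_d9
  have hp := Real.pi_pos
  have he := Real.exp_pos 1
  have h3 := Real.one_sub_inv_le_log_of_pos (div_pos hp he)
  rw [Real.log_div hp.ne' he.ne', Real.log_exp, inv_div] at h3
  have h4 : Real.exp 1 / Real.pi ≤ 0.866 := by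
    rw [div_le_iff₀ hp]; norm_num at *; linarith
  norm_num at *; linarith

theorem numerics {T g l2 lp : ℝ} (hT : 18 ≤ T) (g0 : 1/2 < g) (g1 : g < 2/3) (hl0 : 0.6931 < l2) (hl1 : l2 < 0.6932)
    (hp0 : 1.134 ≤ lp) (hp1 : lp ≤ 1.2) (l : ℝ) (hlog : l ≤ 2 + T / 20) :
    (1 - 2/T) ^ 2 * (2 * l - 4 / T - 2 * l2 - 1 - g) + (4 * (l2 + lp) / T ^ 2 + 4 / T * (1 - 2 / T) * (1 + g / 2 - l2 - lp / 2))
      + (2 / T) * (T - l2 - lp) + 0.1 / T ≤ 2 * l + 1 - g - 2 * l2 - 8 * l / T + 7 / T := by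
  have hT0 : 0 < T := by linarith
  obtain ⟨u, hu⟩ : ∃ u, u = 1 / T := ⟨_, rfl⟩
  have hu0 : 0 < u := by rw [hu]; positivity
  have hu1 : u ≤ 1 / 18 := by rw [hu]; exact one_div_le_one_div_of_le (by norm_num) hT
  have huT : u * T = 1 := by rw [hu]; field_simp
  have e2 : 2 / T = 2 * u := by rw [hu]; ring
  have e4 : 4 / T = 4 * u := by rw [hu]; ring
  have e5 : 4 * (l2 + lp) / T ^ 2 = 4 * (l2 + lp) * u ^ 2 := by rw [hu]; field_simp
  have e6 : 0.1 / T = 0.1 * u := by rw [hu]; ring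
  have e7 : 8 * l / T = 8 * l * u := by rw [hu]; ring
  have e8 : 7 / T = 7 * u := by rw [hu]; ring
  rw [e2, e4, e5, e6, e7, e8]
  have hlu : u * l ≤ 0.1612 := by
    have : u * l ≤ u * (2 + T / 20) := by gcongr
    have h2 : u * (2 + T / 20) = 2 * u + 1 / 20 := by linear_combination (1/20) * huT
    rw [h2] at this
    norm_num at *
    linarith
  have key : 8 * (u * l) - 4 * (1 - 2 * u) ^ 2 + 4 * (1 + g + 2 * l2) * (1 - u) + 4 * u * (l2 + lp)
     + 4 * (1 - 2 * u) * (1 + g / 2 - l2 - lp / 2) - 2 * (l2 + lp) + 0.1 ≤ 7 := by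
    norm_num at *
    nlinarith [mul_nonneg hu0.le (by linarith : 0 ≤ 2/3 - g), mul_nonneg hu0.le (by linarith : 0 ≤ l2 - 0.6931), mul_nonneg hu0.le (by linarith : 0 ≤ lp - 1.134), mul_nonneg hu0.le (by linarith : 0 ≤ 6/5 - lp), mul_nonneg hu0.le (by linarith : 0 ≤ 0.6932 - l2), sq_nonneg u]
  have := mul_le_mul_of_nonneg_left key hu0.le
  have e9 : 2 * u * (T - l2 - lp) = 2 - 2 * u * (l2 + lp) := by linear_combination 2 * huT
  rw [e9]
  linarith

theorem err_bound {T t v : ℝ} (hT : 18 ≤ T) (ht : T ^ 4 / 24 ≤ t) (hv : v = 2 / (T - 2)) :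
    (1 - 2 / T) ^ 2 * (v ^ 6 + 4 / t) + 2 * (2 / T) * (2 / t) ≤ 0.1 / T := by
  have hT0 : 0 < T := by linarith
  have ht0 : 0 < t := lt_of_lt_of_le (by positivity) ht
  have a1 : (1 - 2 / T) ^ 2 ≤ 1 := by
    have : 2 / T ≤ 1 := by rw [div_le_one hT0]; linarith
    have : 0 ≤ 2 / T := by positivity
    nlinarith
  have hT2 : 0 < T - 2 := by linarith
  have hv0 : 0 < v := by rw [hv]; positivity
  have hv1 : v ≤ 1/8 := by rw [hv, div_le_div_iff₀ hT2 (by norm_num)]; linarith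
  have hv2 : v ≤ 3 / T := by rw [hv, div_le_div_iff₀ hT2 hT0]; linarith
  have a2 : v ^ 6 ≤ 0.01 / T := by
    have : v ^ 6 ≤ (1/8) ^ 5 * (3 / T) := by
      calc v ^ 6 = v ^ 5 * v := by ring
        _ ≤ _ := by gcongr
    refine this.trans ?_
    rw [← mul_div_assoc]
    apply div_le_div_of_nonneg_right _ hT0.le
    norm_num
  have a3 : 1 / t ≤ 0.005 / T := by
    rw [div_le_div_iff₀ ht0 hT0]
    have : T ^ 4 ≥ 5832 * T := by
      have : T ^ 3 ≥ 18 ^ 3 := by gcongr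
      nlinarith
    norm_num at *; linarith
  have a4 : 4 / t = 4 * (1 / t) := by ring
  have a5 : 2 / t = 2 * (1 / t) := by ring
  have a6 : 2 * (2 / T) ≤ 1 := by
    rw [← mul_div_assoc, div_le_one hT0]; linarith
  rw [a4, a5]
  have b0 : 0 ≤ 1 / t := by positivity
  have b1 : 0 ≤ v ^ 6 := by positivity
  have c1 : (1 - 2 / T) ^ 2 * (v ^ 6 + 4 * (1 / t)) ≤ 1 * (v ^ 6 + 4 * (1 / t)) := by gcongr
  have c2 : 2 * (2 / T) * (2 * (1 / t)) ≤ 1 * (2 * (1 / t)) := by gcongr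
  have f1 : 0.01 / T = 0.01 * (1 / T) := by ring
  have f2 : 0.005 / T = 0.005 * (1 / T) := by ring
  have f3 : 0.1 / T = 0.1 * (1 / T) := by ring
  rw [f1] at a2
  rw [f2] at a3
  rw [f3]
  have : 0 ≤ 1 / T := by positivity
  norm_num at *
  linarith

end ZL

end PartIJ

/-- Assuming the Riemann hypothesis, for every real `t ≥ e^18`,
`−Re(ζ'/ζ(1 + i t)) ≤ 2 log log t + 1 − γ − log 4 − (8 log log t)/log t + 7/log t`. -/
theorem neg_re_zeta_logDeriv_upper (RH : RiemannHypothesis) (t : ℝ) (ht : Real.exp 18 ≤ t) :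
    -(deriv riemannZeta (1 + t * I) / riemannZeta (1 + t * I)).re ≤
      2 * Real.log (Real.log t) + 1 - Real.eulerMascheroniConstant - Real.log 4
        - 8 * Real.log (Real.log t) / Real.log t + 7 / Real.log t := by
  have ht0 : 0 < t := lt_of_lt_of_le (Real.exp_pos _) ht
  set T := Real.log t with hTdef
  have hT : 18 ≤ T := by
    rw [hTdef, Real.le_log_iff_exp_le ht0]; exact ht
  have htT : t = Real.exp T := (Real.exp_log ht0).symm
  have hT0 : 0 < T := by linarith
  have hT2 : 0 < T - 2 := by linarith
  have ht4 : T ^ 4 / 24 ≤ t := by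
    rw [htT]
    have := Real.pow_div_factorial_le_exp T hT0.le 4
    norm_num [Nat.factorial] at this
    exact this
  have ht6 : 6 ≤ t := by
    refine le_trans ?_ ht4
    have : (18:ℝ) ^ 4 ≤ T ^ 4 := by gcongr
    norm_num at this
    linarith
  set L := 2 * Real.log ((T - 2) / 2) with hLdef
  have hL : 0 < L := by
    have := Real.log_pos (show 1 < (T - 2) / 2 by linarith)
    rw [hLdef]; linarith
  have hv : ZL.vv L = 2 / (T - 2) := by
    rw [ZL.vv, hLdef]
    have : -(2 * Real.log ((T - 2) / 2) / 2) = -Real.log ((T - 2) / 2) := by ring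
    rw [this, Real.exp_neg, Real.exp_log (by linarith), inv_div]
  have hlogT2 : Real.log (T - 2) ≤ Real.log T - 2 / T := by
    have := Real.log_le_sub_one_of_pos (div_pos hT2 hT0)
    rw [Real.log_div hT2.ne' hT0.ne'] at this
    have e : (T - 2) / T - 1 = -(2 / T) := by field_simp; ring
    linarith
  have hLle : L ≤ 2 * Real.log T - 4 / T - 2 * Real.log 2 := by
    rw [hLdef, Real.log_div hT2.ne' (by norm_num)]
    have : 4 / T = 2 * (2 / T) := by ring
    linarith
  have hmain := ZL.Y_bound RH hL ht6
  have hlog : Real.log T ≤ 2 + T / 20 := by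
    have h20 : (20:ℝ) ≤ Real.exp 3 := by
      have := Real.exp_one_gt_d9
      have e : Real.exp 3 = Real.exp 1 ^ 3 := by rw [← Real.exp_nat_mul]; norm_num
      rw [e]
      calc (20:ℝ) ≤ 2.7182818283 ^ 3 := by norm_num
        _ ≤ _ := by gcongr
    have := Real.log_le_sub_one_of_pos (div_pos hT0 (Real.exp_pos 3))
    rw [Real.log_div hT0.ne' (Real.exp_pos 3).ne', Real.log_exp] at this
    have h2 : T / Real.exp 3 ≤ T / 20 := by gcongr
    linarith
  have hpi : Real.log Real.pi ≤ 1.2 := by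
    rw [Real.log_le_iff_le_exp Real.pi_pos]
    have h1 := Real.pi_lt_d4
    have h2 := Real.quadratic_le_exp_of_nonneg (show (0:ℝ) ≤ 0.2 by norm_num)
    have h3 := Real.exp_one_gt_d9
    have e : Real.exp 1.2 = Real.exp 1 * Real.exp 0.2 := by rw [← Real.exp_add]; norm_num
    rw [e]
    norm_num at *
    nlinarith
  have hnum := ZL.numerics hT Real.one_half_lt_eulerMascheroniConstant Real.eulerMascheroniConstant_lt_two_thirds
    (l2 := Real.log 2) (lp := Real.log Real.pi) (by have := Real.log_two_gt_d9; norm_num at *; linarith)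
    (by have := Real.log_two_lt_d9; norm_num at *; linarith) ZL.log_pi_lower hpi (Real.log T) hlog
  have herr := ZL.err_bound hT ht4 hv
  have h4 : Real.log 4 = 2 * Real.log 2 := by
    rw [show (4:ℝ) = 2 ^ 2 by norm_num, Real.log_pow]; push_cast; ring
  rw [h4]
  rw [← hTdef] at hmain
  set v := ZL.vv L with hvdef
  set Y := -(deriv riemannZeta (1 + t * I) / riemannZeta (1 + t * I)).re
  set γ := Real.eulerMascheroniConstant
  set l2 := Real.log 2
  set lp := Real.log Real.pi
  have f1 : (1 - 2 / T) * (1 + v) = 1 := by rw [hv]; field_simp; ring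
  have f2 : (1 - 2 / T) * v = 2 / T := by rw [hv]; field_simp
  have hb := mul_le_mul_of_nonneg_left hmain (sq_nonneg (1 - 2 / T))
  have g1 : (1 - 2 / T) ^ 2 * ((1 + v) ^ 2 * Y) = Y := by
    have : (1 - 2 / T) ^ 2 * ((1 + v) ^ 2 * Y) = ((1 - 2 / T) * (1 + v)) ^ 2 * Y := by ring
    rw [this, f1]; ring
  rw [g1] at hb
  have g2 : (1 - 2 / T) ^ 2 * (L - 1 - γ + v ^ 2 * (l2 + lp) + 2 * v * (1 + γ / 2 - l2 - lp / 2)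
      + 2 * v * (1 + v) * ((T - l2 - lp) / 2 + 2 / t) + v ^ 6 + 4 / t)
      = (1 - 2 / T) ^ 2 * (L - 1 - γ) + ((1 - 2 / T) * v) ^ 2 * (l2 + lp) + 2 * ((1 - 2 / T) * v) * (1 - 2 / T) * (1 + γ / 2 - l2 - lp / 2)
      + 2 * ((1 - 2 / T) * v) * ((1 - 2 / T) * (1 + v)) * ((T - l2 - lp) / 2 + 2 / t) + (1 - 2 / T) ^ 2 * (v ^ 6 + 4 / t) := by ring
  rw [g2, f1, f2] at hb
  have hLm := mul_le_mul_of_nonneg_left hLle (sq_nonneg (1 - 2 / T))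
  have g3 : (2 / T) ^ 2 * (l2 + lp) = 4 * (l2 + lp) / T ^ 2 := by ring
  have g4 : 2 * (2 / T) = 4 / T := by ring
  have g5 : 4 / T * 1 * ((T - l2 - lp) / 2 + 2 / t) = 2 / T * (T - l2 - lp) + 4 / T * (2 / t) := by ring
  rw [g3, g4, g5] at hb
  rw [g4] at herr
  linarith
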